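/- arXiv:1010.0295 — 7 statements merged into one kernel-verified Lean document; each statement's English description precedes it below -/
import Mathlib

section
/- If u, v ∈ ℝ satisfy u² > v², then the point e = (u, 0, 0, v, 0, 0) is an equilibrium of the so(4) free rigid body system and is Lyapunov stable. -/
noncomputable section

/-- The right-hand side of the so(4) free rigid body system on ℝ⁶,
coordinates `(x1,x2,x3,y1,y2,y3) = (p 0, p 1, p 2, p 3, p 4, p 5)`. -/
def vf (l1 l2 l3 l4 : ℝ) (p : Fin 6 → ℝ) : Fin 6 → ℝ :=
  ![(1/(l1+l2) - 1/(l1+l3)) * (p 1 * p 2) + (1/(l3+l4) - 1/(l2+l4)) * (p 4 * p 5),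
    (1/(l2+l3) - 1/(l1+l2)) * (p 0 * p 2) + (1/(l1+l4) - 1/(l3+l4)) * (p 3 * p 5),
    (1/(l1+l3) - 1/(l2+l3)) * (p 0 * p 1) + (1/(l2+l4) - 1/(l1+l4)) * (p 3 * p 4),
    (1/(l3+l4) - 1/(l1+l3)) * (p 1 * p 5) + (1/(l1+l2) - 1/(l2+l4)) * (p 2 * p 4),
    (1/(l2+l3) - 1/(l3+l4)) * (p 0 * p 5) + (1/(l1+l4) - 1/(l1+l2)) * (p 2 * p 3),
    (1/(l2+l4) - 1/(l2+l3)) * (p 0 * p 4) + (1/(l1+l3) - 1/(l1+l4)) * (p 1 * p 3)]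

/-- Lyapunov stability of an equilibrium `e` of the so(4) free rigid body system:
for every ε > 0 there is δ > 0 such that every differentiable solution starting
δ-close to `e` stays ε-close to `e` for all t ≥ 0. -/
def IsLyapunovStable (l1 l2 l3 l4 : ℝ) (e : Fin 6 → ℝ) : Prop :=
  ∀ ε > 0, ∃ δ > 0, ∀ f : ℝ → (Fin 6 → ℝ),
    (∀ t : ℝ, HasDerivAt f (vf l1 l2 l3 l4 (f t)) t) →
    ‖f 0 - e‖ < δ → ∀ t ≥ 0, ‖f t - e‖ < ε

/-- The diagonal quadratic form with weights `p₁, p₂, p₃` on the `x`-coordinates and `q₁, q₂, q₃`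
on the `y`-coordinates. -/
def diagForm (p₁ p₂ p₃ q₁ q₂ q₃ : ℝ) (z : Fin 6 → ℝ) : ℝ :=
  p₁ * z 0 ^ 2 + p₂ * z 1 ^ 2 + p₃ * z 2 ^ 2 + q₁ * z 3 ^ 2 + q₂ * z 4 ^ 2 + q₃ * z 5 ^ 2

/-- The Casimir `x · y`. -/
def pfaffian (z : Fin 6 → ℝ) : ℝ := z 0 * z 3 + z 1 * z 4 + z 2 * z 5

lemma diagForm_solution_const {l1 l2 l3 l4 p₁ p₂ p₃ q₁ q₂ q₃ : ℝ} {f : ℝ → Fin 6 → ℝ}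
    (hf : ∀ t : ℝ, HasDerivAt f (vf l1 l2 l3 l4 (f t)) t)
    (h123 : p₁ * (1/(l1+l2) - 1/(l1+l3)) + p₂ * (1/(l2+l3) - 1/(l1+l2))
      + p₃ * (1/(l1+l3) - 1/(l2+l3)) = 0)
    (h234 : p₁ * (1/(l3+l4) - 1/(l2+l4)) + q₂ * (1/(l2+l3) - 1/(l3+l4))
      + q₃ * (1/(l2+l4) - 1/(l2+l3)) = 0)
    (h134 : p₂ * (1/(l1+l4) - 1/(l3+l4)) + q₁ * (1/(l3+l4) - 1/(l1+l3))
      + q₃ * (1/(l1+l3) - 1/(l1+l4)) = 0)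
    (h124 : p₃ * (1/(l2+l4) - 1/(l1+l4)) + q₁ * (1/(l1+l2) - 1/(l2+l4))
      + q₂ * (1/(l1+l4) - 1/(l1+l2)) = 0) (s t : ℝ) :
    diagForm p₁ p₂ p₃ q₁ q₂ q₃ (f s) = diagForm p₁ p₂ p₃ q₁ q₂ q₃ (f t) := by
  have key (τ : ℝ) : HasDerivAt (fun t => diagForm p₁ p₂ p₃ q₁ q₂ q₃ (f t)) 0 τ := by
    have hc := hasDerivAt_pi.1 (hf τ)
    refine ((((((((hc 0).pow 2).const_mul p₁).add (((hc 1).pow 2).const_mul p₂)).add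
      (((hc 2).pow 2).const_mul p₃)).add (((hc 3).pow 2).const_mul q₁)).add
      (((hc 4).pow 2).const_mul q₂)).add
      (((hc 5).pow 2).const_mul q₃)).congr_deriv ?_
    simp only [vf, Matrix.cons_val, Nat.cast_ofNat, Nat.add_one_sub_one, pow_one]
    linear_combination 2 * f τ 0 * f τ 1 * f τ 2 * h123 + 2 * f τ 0 * f τ 4 * f τ 5 * h234
      + 2 * f τ 1 * f τ 3 * f τ 5 * h134 + 2 * f τ 2 * f τ 3 * f τ 4 * h124
  exact is_const_of_deriv_eq_zero (fun τ => (key τ).differentiableAt) (fun τ => (key τ).deriv) s t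

lemma pfaffian_solution_const {l1 l2 l3 l4 : ℝ} {f : ℝ → Fin 6 → ℝ}
    (hf : ∀ t : ℝ, HasDerivAt f (vf l1 l2 l3 l4 (f t)) t) (s t : ℝ) :
    pfaffian (f s) = pfaffian (f t) := by
  have key (τ : ℝ) : HasDerivAt (fun t => pfaffian (f t)) 0 τ := by
    have hc := hasDerivAt_pi.1 (hf τ)
    refine ((((hc 0).mul (hc 3)).add ((hc 1).mul (hc 4))).add ((hc 2).mul (hc 5))).congr_deriv ?_
    simp only [vf, Matrix.cons_val]
    ring
  exact is_const_of_deriv_eq_zero (fun τ => (key τ).differentiableAt) (fun τ => (key τ).deriv) s t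

/-- Weights given by the divided differences of an arbitrary function of the squares `λᵢ²` satisfy
the condition for a diagonal quadratic form to be a first integral. -/
lemma dividedDifference_triangle {a b c : ℝ} (ga gb gc : ℝ) (hab : b < a) (hbc : c < b)
    (sab : 0 < a + b) (sac : 0 < a + c) (sbc : 0 < b + c) :
    (gb - gc) / (b ^ 2 - c ^ 2) * (1/(a+b) - 1/(a+c)) +
      (ga - gc) / (a ^ 2 - c ^ 2) * (1/(b+c) - 1/(a+b)) +
      (ga - gb) / (a ^ 2 - b ^ 2) * (1/(a+c) - 1/(b+c)) = 0 := by
  have d1 : a - b ≠ 0 := by linarith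
  have d2 : a - c ≠ 0 := by linarith
  have d3 : b - c ≠ 0 := by linarith
  rw [sq_sub_sq, sq_sub_sq, sq_sub_sq]
  field_simp
  ring

lemma exists_coercive_of_sq_lt_mul {p q β : ℝ} (hp : 0 < p) (hq : 0 < q) (h : β ^ 2 < p * q) :
    ∃ c > 0, ∀ x y : ℝ, c * (x ^ 2 + y ^ 2) ≤ p * x ^ 2 + q * y ^ 2 - 2 * β * (x * y) := by
  refine ⟨(p * q - β ^ 2) / (p + q), div_pos (by linarith) (by linarith), fun x y => ?_⟩
  rw [div_mul_eq_mul_div, div_le_iff₀ (by linarith)]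
  nlinarith [sq_nonneg (p * x - β * y), sq_nonneg (q * y - β * x)]

/-- The invariants `(v x₁ - u y₁)² + c (x₂² + x₃² + y₂² + y₃²)` and `|x|² + |y|²` control the
distance to `(u, 0, 0, v, 0, 0)` in the half-space `u x₁ + v y₁ > 0`. -/
lemma exists_norm_sub_lt {u v c ε : ℝ} (hR : 0 < u ^ 2 + v ^ 2) (hc : 0 < c) (hε : 0 < ε) :
    ∃ η > 0, ∀ z : Fin 6 → ℝ,
      (v * z 0 - u * z 3) ^ 2 + c * (z 1 ^ 2 + z 4 ^ 2 + (z 2 ^ 2 + z 5 ^ 2)) < η →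
      |diagForm 1 1 1 1 1 1 z - (u ^ 2 + v ^ 2)| < η →
      u * z 0 + v * z 3 ≠ 0 ∧
        (0 < u * z 0 + v * z 3 → ‖z - ![u, 0, 0, v, 0, 0]‖ < ε) := by
  set R := u ^ 2 + v ^ 2 with hRdef
  set K := R + R / c + 1 with hK
  have hKpos : 0 < K := by positivity
  set M := (K ^ 2 / R ^ 2 + 1) / R + 1 / c with hM
  have hMpos : 0 < M := by positivity
  obtain ⟨η, hη⟩ : ∃ η, η = min 1 (min (R ^ 2 / K) (ε ^ 2 / M)) := ⟨_, rfl⟩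
  have hη0 : 0 < η := by rw [hη]; positivity
  have hη1 : η ≤ 1 := hη.trans_le (min_le_left _ _)
  have hηK : K * η ≤ R ^ 2 := by
    have : η ≤ R ^ 2 / K :=
      hη.trans_le <| (min_le_right _ _).trans (min_le_left _ _)
    rwa [le_div_iff₀ hKpos, mul_comm] at this
  have hηM : η * M ≤ ε ^ 2 := by
    have : η ≤ ε ^ 2 / M :=
      hη.trans_le <| (min_le_right _ _).trans (min_le_right _ _)
    rwa [le_div_iff₀ hMpos] at this
  refine ⟨η, hη0, fun z hz hC => ?_⟩
  set Z := z 1 ^ 2 + z 4 ^ 2 + (z 2 ^ 2 + z 5 ^ 2) with hZ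
  set P := u * z 0 + v * z 3 with hP
  set Q := v * z 0 - u * z 3 with hQ
  have hZ0 : 0 ≤ Z := by positivity
  have hQη : Q ^ 2 < η := by linarith [mul_nonneg hc.le hZ0]
  have hZη : Z < η / c := by rw [lt_div_iff₀ hc]; linarith [sq_nonneg Q]
  have hPR : |P ^ 2 - R ^ 2| < K * η := by
    have hid : P ^ 2 - R ^ 2 = R * (diagForm 1 1 1 1 1 1 z - R) - R * Z - Q ^ 2 := by
      simp only [diagForm, hP, hQ, hZ, hRdef]; ring
    have hKη : K * η = R * η + R * (η / c) + η := by rw [hK]; ring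
    have h1 := abs_lt.1 hC
    have h2 := mul_lt_mul_of_pos_left hZη hR
    have h3 := mul_lt_mul_of_pos_left h1.1 hR
    have h4 := mul_lt_mul_of_pos_left h1.2 hR
    have h5 := mul_nonneg hR.le hZ0
    have h6 : 0 ≤ R * (η / c) := by positivity
    rw [hid, hKη, abs_lt]
    constructor <;> linarith [sq_nonneg Q]
  refine ⟨fun h0 => ?_, fun hpos => ?_⟩
  · rw [h0, abs_lt] at hPR
    linarith [hPR.1]
  · have hsq : (P ^ 2 - R ^ 2) ^ 2 ≤ K ^ 2 * η := by
      have h1 := sq_lt_sq' (abs_lt.1 hPR).1 (abs_lt.1 hPR).2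
      refine h1.le.trans ?_
      rw [mul_pow]
      gcongr
      exact pow_le_of_le_one hη0.le hη1 two_ne_zero
    have hPR2 : (P - R) ^ 2 ≤ K ^ 2 / R ^ 2 * η := by
      rw [div_mul_eq_mul_div, le_div_iff₀ (by positivity)]
      refine le_trans ?_ hsq
      rw [show (P ^ 2 - R ^ 2) ^ 2 = (P - R) ^ 2 * (P + R) ^ 2 by ring]
      exact mul_le_mul_of_nonneg_left (pow_le_pow_left₀ hR.le (by linarith) 2) (sq_nonneg _)
    have hxy : (z 0 - u) ^ 2 + (z 3 - v) ^ 2 = ((P - R) ^ 2 + Q ^ 2) / R := by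
      rw [eq_div_iff hR.ne']
      simp only [hP, hQ, hRdef]; ring
    have hsum : (z 0 - u) ^ 2 + (z 3 - v) ^ 2 + Z < ε ^ 2 := by
      have h1 : ((P - R) ^ 2 + Q ^ 2) / R ≤ (K ^ 2 / R ^ 2 * η + η) / R := by gcongr
      have h2 : η * M = (K ^ 2 / R ^ 2 * η + η) / R + η / c := by rw [hM]; ring
      linarith
    rw [pi_norm_lt_iff hε]
    intro i
    rw [Real.norm_eq_abs]
    refine abs_lt_of_sq_lt_sq (lt_of_le_of_lt ?_ hsum) hε.le
    have := sq_nonneg (z 0 - u)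
    have := sq_nonneg (z 3 - v)
    have := sq_nonneg (z 1)
    have := sq_nonneg (z 2)
    have := sq_nonneg (z 4)
    have := sq_nonneg (z 5)
    fin_cases i <;> simp [hZ] <;> linarith

/-- A definite combination of first integrals, whose diagonal weights are divided differences of
the function with values `u² L₁₄, (u² L₁₄ + v² L₂₃) / 2, (u² L₁₄ - v² L₂₃) / 2, 0` at the points
`λ₁², λ₂², λ₃², λ₄²`, where `Lᵢⱼ = λᵢ² - λⱼ²`. -/
lemma exists_coercive_invariant {l1 l2 l3 l4 u v : ℝ} (h12 : l2 < l1) (h23 : l3 < l2)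
    (h34 : l4 < l3) (s12 : 0 < l1 + l2) (s13 : 0 < l1 + l3) (s14 : 0 < l1 + l4)
    (s23 : 0 < l2 + l3) (s24 : 0 < l2 + l4) (s34 : 0 < l3 + l4) (huv : v ^ 2 < u ^ 2) :
    ∃ F : (Fin 6 → ℝ) → ℝ, ∃ c > 0, Continuous F ∧ F ![u, 0, 0, v, 0, 0] = 0 ∧
      (∀ z, (v * z 0 - u * z 3) ^ 2 + c * (z 1 ^ 2 + z 4 ^ 2 + (z 2 ^ 2 + z 5 ^ 2)) ≤ F z) ∧
      ∀ f : ℝ → Fin 6 → ℝ, (∀ t : ℝ, HasDerivAt f (vf l1 l2 l3 l4 (f t)) t) →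
        ∀ s t, F (f s) = F (f t) := by
  have hA : 0 < l1 ^ 2 - l2 ^ 2 := by nlinarith
  have hB : 0 < l2 ^ 2 - l3 ^ 2 := by nlinarith
  have hC : 0 < l3 ^ 2 - l4 ^ 2 := by nlinarith
  have hAB : 0 < l1 ^ 2 - l3 ^ 2 := by linarith
  have hBC : 0 < l2 ^ 2 - l4 ^ 2 := by linarith
  have hABC : 0 < l1 ^ 2 - l4 ^ 2 := by linarith
  have hu : 0 < u ^ 2 := (sq_nonneg v).trans_lt huv
  set g₁ := u ^ 2 * (l1 ^ 2 - l4 ^ 2) with hg₁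
  set g₂ := (u ^ 2 * (l1 ^ 2 - l4 ^ 2) + v ^ 2 * (l2 ^ 2 - l3 ^ 2)) / 2 with hg₂
  set g₃ := (u ^ 2 * (l1 ^ 2 - l4 ^ 2) - v ^ 2 * (l2 ^ 2 - l3 ^ 2)) / 2 with hg₃
  have hp₁ : (g₂ - g₃) / (l2 ^ 2 - l3 ^ 2) = v ^ 2 := by
    rw [div_eq_iff hB.ne', hg₂, hg₃]; ring
  have hq₁ : (g₁ - 0) / (l1 ^ 2 - l4 ^ 2) = u ^ 2 := by
    rw [div_eq_iff hABC.ne', hg₁]; ring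
  have hg₃_lower : u ^ 2 * ((l1 ^ 2 - l2 ^ 2) + (l3 ^ 2 - l4 ^ 2)) < 2 * g₃ := by
    rw [hg₃]; nlinarith
  have hg₃pos : 0 < g₃ := by
    have := mul_pos hu (add_pos hA hC); linarith
  have hg₂pos : 0 < g₂ := by
    have := mul_nonneg (sq_nonneg v) hB.le; linarith [hg₂, hg₃]
  have hdisc₃ : (u * v) ^ 2 * ((l1 ^ 2 - l2 ^ 2) * (l3 ^ 2 - l4 ^ 2)) < g₃ ^ 2 := by
    have h1 := pow_lt_pow_left₀ hg₃_lower (mul_pos hu (add_pos hA hC)).le two_ne_zero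
    have h2 : v ^ 2 * u ^ 2 ≤ u ^ 2 * u ^ 2 := by gcongr
    have h3 := mul_le_mul_of_nonneg_right h2 (mul_pos hA hC).le
    nlinarith [mul_nonneg (sq_nonneg (u ^ 2)) (sq_nonneg ((l1 ^ 2 - l2 ^ 2) - (l3 ^ 2 - l4 ^ 2)))]
  have hdisc₂ : (u * v) ^ 2 * ((l1 ^ 2 - l3 ^ 2) * (l2 ^ 2 - l4 ^ 2)) < g₂ ^ 2 := by
    have : g₂ ^ 2 - (u * v) ^ 2 * ((l1 ^ 2 - l3 ^ 2) * (l2 ^ 2 - l4 ^ 2)) =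
        g₃ ^ 2 - (u * v) ^ 2 * ((l1 ^ 2 - l2 ^ 2) * (l3 ^ 2 - l4 ^ 2)) := by
      rw [hg₂, hg₃]; ring
    linarith
  have e₁₃ : g₁ - g₃ = g₂ := by rw [hg₁, hg₂, hg₃]; ring
  have e₁₂ : g₁ - g₂ = g₃ := by rw [hg₁, hg₂, hg₃]; ring
  obtain ⟨c₂, hc₂, H₂⟩ := exists_coercive_of_sq_lt_mul (p := (g₁ - g₃) / (l1 ^ 2 - l3 ^ 2))
    (q := (g₂ - 0) / (l2 ^ 2 - l4 ^ 2)) (β := u * v) (by rw [e₁₃]; positivity)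
    (by rw [sub_zero]; positivity)
    (by rw [e₁₃, sub_zero, div_mul_div_comm, lt_div_iff₀ (by positivity)]; linarith)
  obtain ⟨c₃, hc₃, H₃⟩ := exists_coercive_of_sq_lt_mul (p := (g₁ - g₂) / (l1 ^ 2 - l2 ^ 2))
    (q := (g₃ - 0) / (l3 ^ 2 - l4 ^ 2)) (β := u * v) (by rw [e₁₂]; positivity)
    (by rw [sub_zero]; positivity)
    (by rw [e₁₂, sub_zero, div_mul_div_comm, lt_div_iff₀ (by positivity)]; linarith)
  refine ⟨fun z => diagForm ((g₂ - g₃) / (l2 ^ 2 - l3 ^ 2)) ((g₁ - g₃) / (l1 ^ 2 - l3 ^ 2))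
    ((g₁ - g₂) / (l1 ^ 2 - l2 ^ 2)) ((g₁ - 0) / (l1 ^ 2 - l4 ^ 2)) ((g₂ - 0) / (l2 ^ 2 - l4 ^ 2))
    ((g₃ - 0) / (l3 ^ 2 - l4 ^ 2)) z - 2 * (u * v) * pfaffian z, min c₂ c₃, lt_min hc₂ hc₃,
    ?_, ?_, fun z => ?_, fun f hf s t => ?_⟩
  · unfold diagForm pfaffian
    fun_prop
  · simp only [diagForm, pfaffian, Matrix.cons_val, hp₁, hq₁]
    ring
  · have m₂ := mul_le_mul_of_nonneg_right (min_le_left c₂ c₃)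
      (add_nonneg (sq_nonneg (z 1)) (sq_nonneg (z 4)))
    have m₃ := mul_le_mul_of_nonneg_right (min_le_right c₂ c₃)
      (add_nonneg (sq_nonneg (z 2)) (sq_nonneg (z 5)))
    simp only [diagForm, pfaffian, hp₁, hq₁]
    linarith [H₂ (z 1) (z 4), H₃ (z 2) (z 5)]
  · refine congrArg₂ (fun a b => a - 2 * (u * v) * b) (diagForm_solution_const hf
      (dividedDifference_triangle g₁ g₂ g₃ h12 h23 s12 s13 s23) ?_ ?_ ?_ s t)
      (pfaffian_solution_const hf s t)
    · linarith [dividedDifference_triangle g₂ g₃ 0 h23 h34 s23 s24 s34]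
    · linarith [dividedDifference_triangle g₁ g₃ 0 (h23.trans h12) h34 s13 s14 s34]
    · linarith [dividedDifference_triangle g₁ g₂ 0 h12 (h34.trans h23) s12 s14 s24]

/-- the equilibria `(u,0,0,v,0,0)` with `u² > v²` are Lyapunov stable. -/
theorem t1_equilibria_stable
    (l1 l2 l3 l4 : ℝ) (h12 : l2 < l1) (h23 : l3 < l2) (h34 : l4 < l3)
    (s12 : 0 < l1 + l2) (s13 : 0 < l1 + l3) (s14 : 0 < l1 + l4)
    (s23 : 0 < l2 + l3) (s24 : 0 < l2 + l4) (s34 : 0 < l3 + l4)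
    (u v : ℝ) (huv : v ^ 2 < u ^ 2) :
    vf l1 l2 l3 l4 ![u, 0, 0, v, 0, 0] = 0 ∧
      IsLyapunovStable l1 l2 l3 l4 ![u, 0, 0, v, 0, 0] := by
  refine ⟨by ext i; fin_cases i <;> simp [vf], fun ε hε => ?_⟩
  have hR : 0 < u ^ 2 + v ^ 2 := by nlinarith [sq_nonneg v]
  obtain ⟨F, c, hc, hFcont, hFe, hFlower, hFconst⟩ :=
    exists_coercive_invariant h12 h23 h34 s12 s13 s14 s23 s24 s34 huv
  obtain ⟨η, hη, H⟩ := exists_norm_sub_lt hR hc hε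
  set e : Fin 6 → ℝ := ![u, 0, 0, v, 0, 0] with he
  have hCcont : Continuous (fun z => |diagForm 1 1 1 1 1 1 z - (u ^ 2 + v ^ 2)|) := by
    unfold diagForm
    fun_prop
  have hPcont : Continuous (fun z : Fin 6 → ℝ => u * z 0 + v * z 3) := by fun_prop
  have evF : ∀ᶠ z in nhds e, F z < η := hFcont.continuousAt.eventually_lt_const (by rwa [hFe])
  have evC : ∀ᶠ z in nhds e, |diagForm 1 1 1 1 1 1 z - (u ^ 2 + v ^ 2)| < η :=
    hCcont.continuousAt.eventually_lt_const (by simpa [diagForm, he] using hη)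
  have evP : ∀ᶠ z in nhds e, 0 < u * z 0 + v * z 3 :=
    hPcont.continuousAt.eventually_const_lt (by simpa [he, ← sq] using hR)
  obtain ⟨δ, hδ, hball⟩ := Metric.eventually_nhds_iff.1 (evF.and (evC.and evP))
  refine ⟨δ, hδ, fun f hf h0 t ht => ?_⟩
  obtain ⟨hF0, hC0, hP0⟩ := hball (by rwa [dist_eq_norm] : dist (f 0) e < δ)
  have main (s : ℝ) := H (f s) ((hFlower _).trans_lt ((hFconst f hf s 0).trans_lt hF0)) (by
    rwa [diagForm_solution_const hf (by ring) (by ring) (by ring) (by ring) s 0])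
  refine (main t).2 ?_
  by_contra! hneg
  have hfcont : Continuous f := continuous_iff_continuousAt.2 fun s => (hf s).continuousAt
  obtain ⟨s, -, hs⟩ := intermediate_value_Icc' ht (hPcont.comp hfcont).continuousOn
    ⟨hneg, hP0.le⟩
  exact (main s).1 hs
end
end

section
/- Assume λ1² + λ4² ≠ λ2² + λ3², and let α2 be the larger of the two real roots of f̃. If u, v ∈ ℝ satisfy v ≠ 0 and u² < α2·v², then the point e = (u, 0, 0, v, 0, 0) is an equilibrium of the so(4) free rigid body system which is not Lyapunov stable. -/
noncomputable section

open Set Metric Filter Topology in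
/-- A bounded, globally Lipschitz vector field on a Banach space has a global integral curve through
every point. -/
theorem exists_global_integralCurve {E : Type*} [NormedAddCommGroup E] [NormedSpace ℝ E]
    [CompleteSpace E] {w : E → E} {K L : NNReal} (hK : LipschitzWith K w) (hL : ∀ x, ‖w x‖ ≤ L)
    (x₀ : E) : ∃ γ : ℝ → E, γ 0 = x₀ ∧ ∀ t, HasDerivAt γ (w (γ t)) t := by
  have hloc : ∀ n : ℕ, ∃ γ : ℝ → E, γ 0 = x₀ ∧
      ∀ t ∈ Ioo (-((n : ℝ) + 1)) ((n : ℝ) + 1), HasDerivAt γ (w (γ t)) t := by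
    intro n
    have h0 : (0 : ℝ) ∈ Icc (-((n : ℝ) + 1)) ((n : ℝ) + 1) := ⟨by linarith, by positivity⟩
    have hPL : IsPicardLindelof (fun _ ↦ w) ⟨0, h0⟩ x₀ (L * (n + 1)) 0 L K :=
      .of_time_independent (fun x _ ↦ hL x) hK.lipschitzOnWith (by simp)
    obtain ⟨γ, hγ0, hγ⟩ := hPL.exists_eq_forall_mem_Icc_hasDerivWithinAt₀
    exact ⟨γ, hγ0, fun t ht ↦ (hγ t (Ioo_subset_Icc_self ht)).hasDerivAt (Icc_mem_nhds ht.1 ht.2)⟩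
  choose g hg0 hg using hloc
  have hmono : ∀ {m n : ℕ}, m ≤ n → EqOn (g m) (g n) (Ioo (-((m : ℝ) + 1)) ((m : ℝ) + 1)) := by
    intro m n hmn
    have hmn' : (m : ℝ) ≤ n := by exact_mod_cast hmn
    refine ODE_solution_unique_of_mem_Ioo (v := fun _ ↦ w) (s := fun _ ↦ univ) (t₀ := 0)
      (fun _ _ ↦ hK.lipschitzOnWith) ⟨by linarith, by positivity⟩
      (fun t ht ↦ ⟨hg m t ht, trivial⟩)
      (fun t ht ↦ ⟨hg n t ⟨by linarith [ht.1], by linarith [ht.2]⟩, trivial⟩) (by rw [hg0, hg0])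
  refine ⟨fun t ↦ g ⌈|t|⌉₊ t, hg0 _, fun t ↦ ?_⟩
  have hceil : |t| ≤ ⌈|t|⌉₊ := Nat.le_ceil _
  set N := ⌈|t|⌉₊ + 1 with hN
  have key : ∀ s, |s| < |t| + 1 → g ⌈|s|⌉₊ s = g N s := by
    intro s hs
    refine hmono (Nat.ceil_le.2 ?_) (abs_lt.1 ((Nat.le_ceil |s|).trans_lt (lt_add_one _)))
    rw [hN]; push_cast; linarith
  have hev : (fun t ↦ g ⌈|t|⌉₊ t) =ᶠ[𝓝 t] g N := by
    filter_upwards [(continuous_abs.tendsto t).eventually (gt_mem_nhds (lt_add_one |t|))]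
      with s hs using key s hs
  have ht : t ∈ Ioo (-((N : ℝ) + 1)) ((N : ℝ) + 1) := by
    rw [mem_Ioo, ← abs_lt, hN]; push_cast; linarith
  have := (hg N t ht).congr_of_eventuallyEq hev
  rwa [← key t (lt_add_one _)] at this

theorem sum_mul_vf (l1 l2 l3 l4 : ℝ) (p : Fin 6 → ℝ) :
    ∑ i, p i * vf l1 l2 l3 l4 p i = 0 := by
  simp [Fin.sum_univ_six, vf]
  ring

theorem contDiff_vf (l1 l2 l3 l4 : ℝ) : ContDiff ℝ 1 (vf l1 l2 l3 l4) := by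
  rw [contDiff_pi]
  intro i
  fin_cases i <;> simp [vf] <;> fun_prop

open Metric in
/-- The so(4) free rigid body system is complete. -/
theorem exists_vf_solution (l1 l2 l3 l4 : ℝ) (p₀ : Fin 6 → ℝ) :
    ∃ f : ℝ → Fin 6 → ℝ, f 0 = p₀ ∧ ∀ t, HasDerivAt f (vf l1 l2 l3 l4 (f t)) t := by
  set E₀ := ∑ i, p₀ i ^ 2 with hE₀
  have hE₀nn : 0 ≤ E₀ := Finset.sum_nonneg fun i _ ↦ sq_nonneg _
  let χ : ContDiffBump (0 : Fin 6 → ℝ) := ⟨E₀ + 1, E₀ + 2, by linarith, by linarith⟩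
  let w : (Fin 6 → ℝ) → Fin 6 → ℝ := fun p ↦ χ p • vf l1 l2 l3 l4 p
  have hwc : ContDiff ℝ 1 w := χ.contDiff.smul (contDiff_vf l1 l2 l3 l4)
  have hws : HasCompactSupport w := χ.hasCompactSupport.smul_right
  obtain ⟨K, hK⟩ := hws.exists_bound_of_continuous hwc.continuous
  obtain ⟨C, hC⟩ := ContDiff.lipschitzWith_of_hasCompactSupport hws hwc (by norm_num)
  obtain ⟨f, hf0, hf⟩ := exists_global_integralCurve hC (L := K.toNNReal)
    (fun x ↦ (hK x).trans (Real.le_coe_toNNReal K)) p₀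
  have hcoord : ∀ t i, HasDerivAt (fun s ↦ f s i) (w (f t) i) t :=
    fun t i ↦ (hasDerivAt_pi.1 (hf t)) i
  have hE : ∀ t, HasDerivAt (fun s ↦ ∑ i, f s i ^ 2) 0 t := by
    intro t
    have h := HasDerivAt.fun_sum (u := Finset.univ) fun i _ ↦ (hcoord t i).pow 2
    refine h.congr_deriv (Eq.symm ?_)
    have := sum_mul_vf l1 l2 l3 l4 (f t)
    calc (0 : ℝ) = 2 * χ (f t) * ∑ i, f t i * vf l1 l2 l3 l4 (f t) i := by rw [this, mul_zero]
      _ = _ := by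
        rw [Finset.mul_sum]
        refine Finset.sum_congr rfl fun i _ ↦ ?_
        simp only [w, Pi.smul_apply, smul_eq_mul]
        ring
  have hconst : ∀ t, ∑ i, f t i ^ 2 = E₀ := by
    intro t
    rw [is_const_of_deriv_eq_zero (fun s ↦ (hE s).differentiableAt) (fun s ↦ (hE s).deriv) t 0, hf0]
  refine ⟨f, hf0, fun t ↦ ?_⟩
  have hball : f t ∈ closedBall (0 : Fin 6 → ℝ) (E₀ + 1) := by
    rw [mem_closedBall_zero_iff, pi_norm_le_iff_of_nonneg (by linarith)]
    intro i
    have : f t i ^ 2 ≤ E₀ := by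
      rw [← hconst t]
      exact Finset.single_le_sum (f := fun i ↦ f t i ^ 2) (fun j _ ↦ sq_nonneg _)
        (Finset.mem_univ i)
    rw [Real.norm_eq_abs]
    nlinarith [sq_abs (f t i), sq_nonneg (|f t i| - 1), abs_nonneg (f t i)]
  have h1 : w (f t) = vf l1 l2 l3 l4 (f t) := by
    simp only [w]
    rw [χ.one_of_mem_closedBall hball, one_smul]
  rw [← h1]
  exact hf t

theorem exists_coercive_of_det_ne_zero {a b c d : ℝ} (h : a * d - b * c ≠ 0) :
    ∃ k > 0, ∀ x y : ℝ, k * (x ^ 2 + y ^ 2) ≤ (a * x + b * y) ^ 2 + (c * x + d * y) ^ 2 := by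
  have hF : 0 < a ^ 2 + b ^ 2 + c ^ 2 + d ^ 2 := by
    by_contra! hF
    have ha : a = 0 := by nlinarith [sq_nonneg a, sq_nonneg b, sq_nonneg c, sq_nonneg d]
    have hb : b = 0 := by nlinarith [sq_nonneg a, sq_nonneg b, sq_nonneg c, sq_nonneg d]
    simp [ha, hb] at h
  refine ⟨(a * d - b * c) ^ 2 / (a ^ 2 + b ^ 2 + c ^ 2 + d ^ 2), by positivity, fun x y ↦ ?_⟩
  rw [div_mul_eq_mul_div, div_le_iff₀ hF]
  nlinarith [sq_nonneg (a * (a * x + b * y) + c * (c * x + d * y)),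
    sq_nonneg (b * (a * x + b * y) + d * (c * x + d * y))]

/-- Let `A = !![a11, a12; a21, a22]` and `B = !![b11, b12; b21, b22]` be such that `B * A` has
determinant `δ ^ 2 > 0` and no eigenvalue in `(-∞, 0]`, i.e. `tr (B * A) + 2 * δ > 0`. Then some
bilinear form `Pᵀ * M * R` has a positive definite derivative along the linear system
`P' = A * R`, `R' = B * P`. -/
theorem exists_form_deriv_coercive {a11 a12 a21 a22 b11 b12 b21 b22 δ : ℝ} (hδ : 0 < δ)
    (hdet : δ ^ 2 = (a11 * a22 - a12 * a21) * (b11 * b22 - b12 * b21))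
    (htr : 0 < b11 * a11 + b12 * a21 + b21 * a12 + b22 * a22 + 2 * δ) :
    ∃ m11 m12 m21 m22 k : ℝ, 0 < k ∧ ∀ p1 p2 r1 r2 : ℝ,
      k * (p1 ^ 2 + p2 ^ 2 + r1 ^ 2 + r2 ^ 2) ≤
        m11 * ((a11 * r1 + a12 * r2) * r1 + p1 * (b11 * p1 + b12 * p2)) +
        m12 * ((a11 * r1 + a12 * r2) * r2 + p1 * (b21 * p1 + b22 * p2)) +
        m21 * ((a21 * r1 + a22 * r2) * r1 + p2 * (b11 * p1 + b12 * p2)) +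
        m22 * ((a21 * r1 + a22 * r2) * r2 + p2 * (b21 * p1 + b22 * p2)) := by
  set τ := b11 * a11 + b12 * a21 + b21 * a12 + b22 * a22 + 2 * δ with hτ
  -- `K = B * A`, and `J = K + δ` satisfies `J ^ 2 = τ * K` by Cayley-Hamilton
  set k11 := b11 * a11 + b12 * a21 with hk11
  set k12 := b11 * a12 + b12 * a22 with hk12
  set k21 := b21 * a11 + b22 * a21 with hk21
  set k22 := b21 * a12 + b22 * a22 with hk22
  have hτ' : τ = k11 + k22 + 2 * δ := by rw [hτ, hk11, hk22]; ring
  have hK : k11 * k22 - k12 * k21 = δ ^ 2 := by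
    rw [hdet, hk11, hk12, hk21, hk22]; ring
  have hB : b11 * b22 - b12 * b21 ≠ 0 := by
    intro h
    rw [h, mul_zero] at hdet
    exact hδ.ne' (pow_eq_zero_iff two_ne_zero |>.1 hdet)
  have hJ : (k11 + δ) * (k22 + δ) - k12 * k21 ≠ 0 := by
    have : (k11 + δ) * (k22 + δ) - k12 * k21 = δ * τ := by rw [hτ']; linear_combination hK
    rw [this]; positivity
  obtain ⟨κ, hκ, hκB⟩ := exists_coercive_of_det_ne_zero hB
  obtain ⟨κ', hκ', hκJ⟩ := exists_coercive_of_det_ne_zero hJ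
  refine ⟨b11 * τ + b21 * (k21 - k12), b11 * (k12 - k21) + b21 * τ,
    b12 * τ + b22 * (k21 - k12), b12 * (k12 - k21) + b22 * τ, min (τ * κ) κ',
    lt_min (by positivity) hκ', fun p1 p2 r1 r2 ↦ ?_⟩
  calc min (τ * κ) κ' * (p1 ^ 2 + p2 ^ 2 + r1 ^ 2 + r2 ^ 2)
      = min (τ * κ) κ' * (p1 ^ 2 + p2 ^ 2) + min (τ * κ) κ' * (r1 ^ 2 + r2 ^ 2) := by ring
    _ ≤ τ * κ * (p1 ^ 2 + p2 ^ 2) + κ' * (r1 ^ 2 + r2 ^ 2) := by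
        gcongr
        · exact min_le_left _ _
        · exact min_le_right _ _
    _ ≤ τ * ((b11 * p1 + b12 * p2) ^ 2 + (b21 * p1 + b22 * p2) ^ 2) +
          (((k11 + δ) * r1 + k12 * r2) ^ 2 + (k21 * r1 + (k22 + δ) * r2) ^ 2) := by
        rw [mul_assoc]
        gcongr
        · exact hκB p1 p2
        · exact hκJ r1 r2
    _ = τ * ((b11 * p1 + b12 * p2) ^ 2 + (b21 * p1 + b22 * p2) ^ 2) +
          ((k11 * r1 + k12 * r2) * (τ * r1 + (k12 - k21) * r2) +
            (k21 * r1 + k22 * r2) * ((k21 - k12) * r1 + τ * r2)) := by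
        rw [hτ']
        linear_combination (-(r1 ^ 2 + r2 ^ 2)) * hK
    _ = _ := by
        rw [hk11, hk12, hk21, hk22]
        ring

theorem trace_add_eq {l1 l2 l3 l4 : ℝ} (s12 : l1 + l2 ≠ 0) (s13 : l1 + l3 ≠ 0)
    (s14 : l1 + l4 ≠ 0) (s23 : l2 + l3 ≠ 0) (s24 : l2 + l4 ≠ 0) (s34 : l3 + l4 ≠ 0) (u v g : ℝ) :
    (1/(l1+l3) - 1/(l2+l3)) * u * ((1/(l2+l3) - 1/(l1+l2)) * u) +
      (1/(l2+l4) - 1/(l1+l4)) * v * ((1/(l1+l4) - 1/(l1+l2)) * v) +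
      (1/(l1+l3) - 1/(l1+l4)) * v * ((1/(l1+l4) - 1/(l3+l4)) * v) +
      (1/(l2+l4) - 1/(l2+l3)) * u * ((1/(l2+l3) - 1/(l3+l4)) * u) +
      2 * (g * ((l2 + l3) ^ 2 * v ^ 2 - (l1 + l4) ^ 2 * u ^ 2) /
        ((l1 + l2) * (l3 + l4) * (l1 + l3) * (l2 + l4) * (l2 + l3) ^ 2 * (l1 + l4) ^ 2)) =
    ((l2 + l3) ^ 2 * v ^ 2 * ((l1 - l3) * (l3 - l4) * (l1 + l2) * (l2 + l4) +
        (l2 - l4) * (l1 - l2) * (l3 + l4) * (l1 + l3) + 2 * g) -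
      (l1 + l4) ^ 2 * u ^ 2 * ((l1 - l3) * (l1 - l2) * (l3 + l4) * (l2 + l4) +
        (l2 - l4) * (l3 - l4) * (l1 + l2) * (l1 + l3) + 2 * g)) /
      ((l1 + l2) * (l3 + l4) * (l1 + l3) * (l2 + l4) * (l2 + l3) ^ 2 * (l1 + l4) ^ 2) := by
  rw [div_sub_div _ _ s13 s23, div_sub_div _ _ s23 s12, div_sub_div _ _ s24 s14,
    div_sub_div _ _ s14 s12, div_sub_div _ _ s13 s14, div_sub_div _ _ s14 s34,
    div_sub_div _ _ s24 s23, div_sub_div _ _ s23 s34]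
  field_simp
  ring

/-- The condition `u ^ 2 < α * v ^ 2` in terms of the linearisation at `(u, 0, 0, v, 0, 0)`. -/
theorem exists_sqrt_det_of_lt {l1 l2 l3 l4 : ℝ} (h12 : l2 < l1) (h23 : l3 < l2) (h34 : l4 < l3)
    (s12 : 0 < l1 + l2) (s13 : 0 < l1 + l3) (s14 : 0 < l1 + l4)
    (s23 : 0 < l2 + l3) (s24 : 0 < l2 + l4) (s34 : 0 < l3 + l4) {α : ℝ}
    (hr : (l1^2 - l4^2)^2 * α ^ 2
        - 2 * ((l1^2 - l2^2) * (l3^2 - l4^2) + (l1^2 - l3^2) * (l2^2 - l4^2)) * α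
        + (l2^2 - l3^2)^2 = 0)
    {u v : ℝ} (hv : v ≠ 0) (hu : u ^ 2 < α * v ^ 2) :
    ∃ δ > 0,
      δ ^ 2 =
        ((1/(l2+l3) - 1/(l1+l2)) * u * ((1/(l2+l3) - 1/(l3+l4)) * u) -
          (1/(l1+l4) - 1/(l3+l4)) * v * ((1/(l1+l4) - 1/(l1+l2)) * v)) *
        ((1/(l1+l3) - 1/(l2+l3)) * u * ((1/(l2+l4) - 1/(l2+l3)) * u) -
          (1/(l2+l4) - 1/(l1+l4)) * v * ((1/(l1+l3) - 1/(l1+l4)) * v)) ∧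
      0 < (1/(l1+l3) - 1/(l2+l3)) * u * ((1/(l2+l3) - 1/(l1+l2)) * u) +
          (1/(l2+l4) - 1/(l1+l4)) * v * ((1/(l1+l4) - 1/(l1+l2)) * v) +
          (1/(l1+l3) - 1/(l1+l4)) * v * ((1/(l1+l4) - 1/(l3+l4)) * v) +
          (1/(l2+l4) - 1/(l2+l3)) * u * ((1/(l2+l3) - 1/(l3+l4)) * u) + 2 * δ := by
  have d12 : 0 < l1 - l2 := by linarith
  have d13 : 0 < l1 - l3 := by linarith
  have d14 : 0 < l1 - l4 := by linarith
  have d24 : 0 < l2 - l4 := by linarith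
  have d34 : 0 < l3 - l4 := by linarith
  set P := (l1^2 - l2^2) * (l3^2 - l4^2) with hP
  set Q := (l1^2 - l3^2) * (l2^2 - l4^2) with hQ
  set X := (l1 - l3) * (l1 - l2) * (l3 + l4) * (l2 + l4) +
    (l2 - l4) * (l3 - l4) * (l1 + l2) * (l1 + l3) with hX
  set Y := (l1 - l3) * (l3 - l4) * (l1 + l2) * (l2 + l4) +
    (l2 - l4) * (l1 - l2) * (l3 + l4) * (l1 + l3) with hY
  have hPpos : 0 < P := by
    have : P = (l1 - l2) * (l1 + l2) * ((l3 - l4) * (l3 + l4)) := by rw [hP]; ring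
    rw [this]; positivity
  have hQpos : 0 < Q := by
    have : Q = (l1 - l3) * (l1 + l3) * ((l2 - l4) * (l2 + l4)) := by rw [hQ]; ring
    rw [this]; positivity
  have hXpos : 0 < X := by positivity
  set g := √(P * Q) with hg
  have hgpos : 0 < g := Real.sqrt_pos.2 (by positivity)
  have hg2 : g ^ 2 = P * Q := Real.sq_sqrt (by positivity)
  have hσX : (l2 + l3) ^ 2 * (l1 - l4) ^ 2 = P + Q + X := by rw [hP, hQ, hX]; ring
  have hXY : (P + Q) * (Y - X) + X * Y = 4 * (P * Q) := by rw [hP, hQ, hX, hY]; ring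
  have hXg : 2 * g ≤ X := by
    refine le_of_sq_le_sq ?_ hXpos.le
    have : X ^ 2 - 4 * (P * Q) = ((l1 - l3) * (l1 - l2) * (l3 + l4) * (l2 + l4) -
      (l2 - l4) * (l3 - l4) * (l1 + l2) * (l1 + l3)) ^ 2 := by rw [hP, hQ, hX]; ring
    nlinarith [sq_nonneg ((l1 - l3) * (l1 - l2) * (l3 + l4) * (l2 + l4) -
      (l2 - l4) * (l3 - l4) * (l1 + l2) * (l1 + l3))]
  have hS : 0 < (l1 + l4) ^ 2 * (l1 - l4) ^ 2 := by positivity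
  have hα : (l1 + l4) ^ 2 * (l1 - l4) ^ 2 * α ≤ P + Q + 2 * g := by
    have hsq : ((l1 + l4) ^ 2 * (l1 - l4) ^ 2 * α - (P + Q)) ^ 2 = (2 * g) ^ 2 := by
      have hU : (l1^2 - l4^2)^2 * (l2^2 - l3^2)^2 = (Q - P) ^ 2 := by rw [hP, hQ]; ring
      linear_combination (l1^2 - l4^2)^2 * hr - hU - 4 * hg2
    have := (abs_le.1 (abs_le_of_sq_le_sq hsq.le (by positivity))).2
    linarith
  have hv2 : 0 < v ^ 2 := by positivity
  have hu' : (l1 + l4) ^ 2 * (l1 - l4) ^ 2 * u ^ 2 < (P + Q + 2 * g) * v ^ 2 := by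
    calc _ < (l1 + l4) ^ 2 * (l1 - l4) ^ 2 * (α * v ^ 2) := by gcongr
      _ = (l1 + l4) ^ 2 * (l1 - l4) ^ 2 * α * v ^ 2 := by ring
      _ ≤ _ := by gcongr
  have hρ : 0 < (l2 + l3) ^ 2 * v ^ 2 - (l1 + l4) ^ 2 * u ^ 2 := by
    refine pos_of_mul_pos_right (a := (l1 - l4) ^ 2) ?_ (by positivity)
    have h1 : 0 ≤ (X - 2 * g) * v ^ 2 := mul_nonneg (by linarith) hv2.le
    have h2 : (l1 - l4) ^ 2 * ((l2 + l3) ^ 2 * v ^ 2) = (P + Q + X) * v ^ 2 := by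
      linear_combination v ^ 2 * hσX
    linarith
  have hτ : 0 < (l2 + l3) ^ 2 * v ^ 2 * (Y + 2 * g) - (l1 + l4) ^ 2 * u ^ 2 * (X + 2 * g) := by
    refine pos_of_mul_pos_right (a := (l1 - l4) ^ 2) ?_ (by positivity)
    have h1 := mul_lt_mul_of_pos_right hu' (by positivity : 0 < X + 2 * g)
    have h2 : (P + Q + X) * (Y + 2 * g) = (P + Q + 2 * g) * (X + 2 * g) := by
      linear_combination hXY - 4 * hg2
    have h3 : (l1 - l4) ^ 2 * ((l2 + l3) ^ 2 * v ^ 2 * (Y + 2 * g)) =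
        (P + Q + 2 * g) * v ^ 2 * (X + 2 * g) := by
      linear_combination v ^ 2 * (Y + 2 * g) * hσX + v ^ 2 * h2
    linarith
  refine ⟨g * ((l2 + l3) ^ 2 * v ^ 2 - (l1 + l4) ^ 2 * u ^ 2) / ((l1 + l2) * (l3 + l4) * (l1 + l3) *
    (l2 + l4) * (l2 + l3) ^ 2 * (l1 + l4) ^ 2), by positivity, ?_, ?_⟩
  · rw [div_pow, mul_pow, hg2, hP, hQ]
    field_simp
    ring
  · rw [trace_add_eq s12.ne' s13.ne' s14.ne' s23.ne' s24.ne' s34.ne']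
    positivity

theorem abs_binary_form_le (α β γ x y : ℝ) :
    |α * x ^ 2 + β * (x * y) + γ * y ^ 2| ≤ (|α| + |β| + |γ|) * (x ^ 2 + y ^ 2) := by
  have hxy : |x * y| ≤ x ^ 2 + y ^ 2 := by
    rw [abs_le]
    constructor <;> nlinarith [sq_nonneg (x + y), sq_nonneg (x - y), sq_nonneg x, sq_nonneg y]
  calc |α * x ^ 2 + β * (x * y) + γ * y ^ 2|
      ≤ |α * x ^ 2| + |β * (x * y)| + |γ * y ^ 2| := abs_add_three _ _ _
    _ = |α| * x ^ 2 + |β| * |x * y| + |γ| * y ^ 2 := by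
        rw [abs_mul, abs_mul β, abs_mul γ, abs_of_nonneg (sq_nonneg x), abs_of_nonneg (sq_nonneg y)]
    _ ≤ |α| * (x ^ 2 + y ^ 2) + |β| * (x ^ 2 + y ^ 2) + |γ| * (x ^ 2 + y ^ 2) := by
        gcongr
        · linarith [sq_nonneg y]
        · linarith [sq_nonneg x]
    _ = _ := by ring

/-- If a function `V` has derivative at least `c * n` with `c > 0`, where `n` is a bounded function
dominating `V` up to a constant, then `V` cannot start at a positive value. -/
theorem nonpos_of_mul_le_deriv {V V' n : ℝ → ℝ} {c C B : ℝ} (hc : 0 < c) (hC : 0 < C)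
    (hV : ∀ t, HasDerivAt V (V' t) t) (hn : ∀ t, 0 ≤ n t) (hV' : ∀ t ≥ 0, c * n t ≤ V' t)
    (hVn : ∀ t, V t ≤ C * n t) (hB : ∀ t ≥ 0, n t ≤ B) : V 0 ≤ 0 := by
  by_contra! h0
  have growth : ∀ m : ℝ, (∀ t ≥ 0, m ≤ V' t) → ∀ t ≥ 0, m * t ≤ V t - V 0 := by
    intro m hm t ht
    have := (convex_Ici (0 : ℝ)).mul_sub_le_image_sub_of_le_deriv (f := V) (C := m)
      (fun s _ ↦ (hV s).continuousAt.continuousWithinAt)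
      (fun s _ ↦ (hV s).differentiableAt.differentiableWithinAt)
      (fun s hs ↦ by
        rw [interior_Ici] at hs
        rw [(hV s).deriv]
        exact hm s (le_of_lt hs)) 0 Set.self_mem_Ici t ht ht
    simpa using this
  have hmono : ∀ t ≥ 0, V 0 ≤ V t := fun t ht ↦ by
    have := growth 0 (fun s hs ↦ (mul_nonneg hc.le (hn s)).trans (hV' s hs)) t ht
    linarith
  have hμ : 0 < c * (V 0 / C) := by positivity
  have hlin := growth (c * (V 0 / C)) fun t ht ↦ by
    refine le_trans ?_ (hV' t ht)
    gcongr
    rw [div_le_iff₀' hC]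
    exact (hmono t ht).trans (hVn t)
  have hB0 : 0 ≤ B := (hn 0).trans (hB 0 le_rfl)
  have hT : 0 ≤ C * B / (c * (V 0 / C)) := by positivity
  have h1 := hlin _ hT
  rw [mul_div_cancel₀ _ hμ.ne'] at h1
  have h2 := (hVn _).trans (mul_le_mul_of_nonneg_left (hB _ hT) hC.le)
  linarith

/-- Instability of the zero solution of a system `P' = A(x, y) * R`, `R' = B(x, y) * P` whose
coefficients depend linearly on parameters `(x, y)` varying near `(u, v)`, given a bilinear form
whose derivative is positive definite at `(x, y) = (u, v)`. -/
theorem exists_radius_form_nonpos {a b p q c d r s u v m11 m12 m21 m22 k : ℝ} (hk : 0 < k)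
    (hform : ∀ p1 p2 r1 r2 : ℝ, k * (p1 ^ 2 + p2 ^ 2 + r1 ^ 2 + r2 ^ 2) ≤
      m11 * ((a * u * r1 + b * v * r2) * r1 + p1 * (c * u * p1 + d * v * p2)) +
      m12 * ((a * u * r1 + b * v * r2) * r2 + p1 * (s * v * p1 + r * u * p2)) +
      m21 * ((q * v * r1 + p * u * r2) * r1 + p2 * (c * u * p1 + d * v * p2)) +
      m22 * ((q * v * r1 + p * u * r2) * r2 + p2 * (s * v * p1 + r * u * p2))) :
    ∃ ε > 0, ∀ x y P1 P2 R1 R2 : ℝ → ℝ,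
      (∀ t, HasDerivAt P1 (a * x t * R1 t + b * y t * R2 t) t) →
      (∀ t, HasDerivAt P2 (q * y t * R1 t + p * x t * R2 t) t) →
      (∀ t, HasDerivAt R1 (c * x t * P1 t + d * y t * P2 t) t) →
      (∀ t, HasDerivAt R2 (s * y t * P1 t + r * x t * P2 t) t) →
      (∀ t ≥ 0, |x t - u| < ε ∧ |y t - v| < ε ∧
        |P1 t| < ε ∧ |P2 t| < ε ∧ |R1 t| < ε ∧ |R2 t| < ε) →
      m11 * (P1 0 * R1 0) + m12 * (P1 0 * R2 0) + m21 * (P2 0 * R1 0) + m22 * (P2 0 * R2 0) ≤ 0 := by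
  -- the derivative of the form at `(x, y)`, split by linearity
  set D : ℝ → ℝ → ℝ → ℝ → ℝ → ℝ → ℝ := fun x y p1 p2 r1 r2 ↦
      m11 * ((a * x * r1 + b * y * r2) * r1 + p1 * (c * x * p1 + d * y * p2)) +
      m12 * ((a * x * r1 + b * y * r2) * r2 + p1 * (s * y * p1 + r * x * p2)) +
      m21 * ((q * y * r1 + p * x * r2) * r1 + p2 * (c * x * p1 + d * y * p2)) +
      m22 * ((q * y * r1 + p * x * r2) * r2 + p2 * (s * y * p1 + r * x * p2)) with hD
  have hbound : ∀ x y : ℝ, ∃ C, ∀ p1 p2 r1 r2 : ℝ,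
      |D x y p1 p2 r1 r2| ≤ C * (p1 ^ 2 + p2 ^ 2 + r1 ^ 2 + r2 ^ 2) := by
    intro x y
    let α := m11 * (c * x) + m12 * (s * y)
    let β := m11 * (d * y) + m12 * (r * x) + m21 * (c * x) + m22 * (s * y)
    let γ := m21 * (d * y) + m22 * (r * x)
    let α' := m11 * (a * x) + m21 * (q * y)
    let β' := m11 * (b * y) + m12 * (a * x) + m21 * (p * x) + m22 * (q * y)
    let γ' := m12 * (b * y) + m22 * (p * x)
    refine ⟨(|α| + |β| + |γ|) + (|α'| + |β'| + |γ'|), fun p1 p2 r1 r2 ↦ ?_⟩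
    have h1 := abs_binary_form_le α β γ p1 p2
    have h2 := abs_binary_form_le α' β' γ' r1 r2
    have hsplit : D x y p1 p2 r1 r2 = (α * p1 ^ 2 + β * (p1 * p2) + γ * p2 ^ 2) +
        (α' * r1 ^ 2 + β' * (r1 * r2) + γ' * r2 ^ 2) := by
      simp only [hD, α, β, γ, α', β', γ']
      ring
    have h3 : 0 ≤ (|α| + |β| + |γ|) * (r1 ^ 2 + r2 ^ 2) := by positivity
    have h4 : 0 ≤ (|α'| + |β'| + |γ'|) * (p1 ^ 2 + p2 ^ 2) := by positivity
    rw [hsplit]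
    linarith [abs_add_le (α * p1 ^ 2 + β * (p1 * p2) + γ * p2 ^ 2)
      (α' * r1 ^ 2 + β' * (r1 * r2) + γ' * r2 ^ 2)]
  obtain ⟨C₁, hC₁⟩ := hbound 1 0
  obtain ⟨C₂, hC₂⟩ := hbound 0 1
  set ε := k / (2 * (|C₁| + |C₂| + 1)) with hε
  have hεpos : 0 < ε := by positivity
  have hεC : ε * (|C₁| + |C₂|) ≤ k / 2 := by
    calc ε * (|C₁| + |C₂|) ≤ ε * (|C₁| + |C₂| + 1) := mul_le_mul_of_nonneg_left (by linarith) hεpos.le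
      _ = k / 2 := by rw [hε]; field_simp
  refine ⟨ε, hεpos, fun x y P1 P2 R1 R2 hP1 hP2 hR1 hR2 hclose ↦ ?_⟩
  set n : ℝ → ℝ := fun t ↦ P1 t ^ 2 + P2 t ^ 2 + R1 t ^ 2 + R2 t ^ 2 with hn
  have hn0 : ∀ t, 0 ≤ n t := fun t ↦ by positivity
  refine nonpos_of_mul_le_deriv
    (V := fun t ↦ m11 * (P1 t * R1 t) + m12 * (P1 t * R2 t) + m21 * (P2 t * R1 t) +
      m22 * (P2 t * R2 t))
    (V' := fun t ↦ D (x t) (y t) (P1 t) (P2 t) (R1 t) (R2 t)) (n := n)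
    (c := k / 2) (C := |m11| + |m12| + |m21| + |m22| + 1) (B := 4 * ε ^ 2)
    (by positivity) (by positivity) (fun t ↦ ?_) hn0 (fun t ht ↦ ?_) (fun t ↦ ?_) (fun t ht ↦ ?_)
  · exact ((((((hP1 t).mul (hR1 t)).const_mul m11).add (((hP1 t).mul (hR2 t)).const_mul m12)).add
      (((hP2 t).mul (hR1 t)).const_mul m21)).add (((hP2 t).mul (hR2 t)).const_mul m22))
  · obtain ⟨hx, hy, -⟩ := hclose t ht
    have hsplit : D (x t) (y t) (P1 t) (P2 t) (R1 t) (R2 t) =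
        D u v (P1 t) (P2 t) (R1 t) (R2 t) + (x t - u) * D 1 0 (P1 t) (P2 t) (R1 t) (R2 t) +
          (y t - v) * D 0 1 (P1 t) (P2 t) (R1 t) (R2 t) := by
      simp only [hD]
      ring
    have key : ∀ {z w C : ℝ}, |z| < ε → |w| ≤ C * n t → -(ε * |C| * n t) ≤ z * w := by
      intro z w C hz hw
      refine (neg_le_neg ?_).trans (neg_abs_le _)
      calc |z * w| = |z| * |w| := abs_mul _ _
        _ ≤ ε * (|C| * n t) :=
          mul_le_mul hz.le (hw.trans (mul_le_mul_of_nonneg_right (le_abs_self C) (hn0 t)))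
            (abs_nonneg _) hεpos.le
        _ = _ := by ring
    have h1 := key hx (hC₁ (P1 t) (P2 t) (R1 t) (R2 t))
    have h2 := key hy (hC₂ (P1 t) (P2 t) (R1 t) (R2 t))
    have h3 : k * n t ≤ D u v (P1 t) (P2 t) (R1 t) (R2 t) := hform _ _ _ _
    have h4 := mul_le_mul_of_nonneg_right hεC (hn0 t)
    change k / 2 * n t ≤ D (x t) (y t) (P1 t) (P2 t) (R1 t) (R2 t)
    linarith
  · have key : ∀ m z w : ℝ, z ^ 2 + w ^ 2 ≤ n t → m * (z * w) ≤ |m| * n t := by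
      intro m z w h
      refine (le_abs_self _).trans ?_
      rw [abs_mul]
      gcongr
      rw [abs_le]
      constructor <;> nlinarith [sq_nonneg (z + w), sq_nonneg (z - w), sq_nonneg z, sq_nonneg w]
    have h1 := sq_nonneg (P1 t)
    have h2 := sq_nonneg (P2 t)
    have h3 := sq_nonneg (R1 t)
    have h4 := sq_nonneg (R2 t)
    have := key m11 (P1 t) (R1 t) (by simp only [hn]; linarith)
    have := key m12 (P1 t) (R2 t) (by simp only [hn]; linarith)
    have := key m21 (P2 t) (R1 t) (by simp only [hn]; linarith)
    have := key m22 (P2 t) (R2 t) (by simp only [hn]; linarith)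
    linarith [hn0 t]
  · obtain ⟨-, -, h1, h2, h3, h4⟩ := hclose t ht
    have key : ∀ {z : ℝ}, |z| < ε → z ^ 2 ≤ ε ^ 2 := fun {z} h ↦
      sq_le_sq' (abs_lt.1 h).1.le (abs_lt.1 h).2.le
    simp only [hn]
    linarith [key h1, key h2, key h3, key h4]

/-- If the square of the linearisation at `(u, 0, 0, v, 0, 0)` in the directions `(x2, x3, y2, y3)`
has no eigenvalue in `(-∞, 0]`, then this equilibrium is unstable. -/
theorem not_isLyapunovStable_of_linearization {l1 l2 l3 l4 u v δ : ℝ} (hδ : 0 < δ)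
    (hdet : δ ^ 2 =
      ((1/(l2+l3) - 1/(l1+l2)) * u * ((1/(l2+l3) - 1/(l3+l4)) * u) -
        (1/(l1+l4) - 1/(l3+l4)) * v * ((1/(l1+l4) - 1/(l1+l2)) * v)) *
      ((1/(l1+l3) - 1/(l2+l3)) * u * ((1/(l2+l4) - 1/(l2+l3)) * u) -
        (1/(l2+l4) - 1/(l1+l4)) * v * ((1/(l1+l3) - 1/(l1+l4)) * v)))
    (htr : 0 < (1/(l1+l3) - 1/(l2+l3)) * u * ((1/(l2+l3) - 1/(l1+l2)) * u) +
      (1/(l2+l4) - 1/(l1+l4)) * v * ((1/(l1+l4) - 1/(l1+l2)) * v) +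
      (1/(l1+l3) - 1/(l1+l4)) * v * ((1/(l1+l4) - 1/(l3+l4)) * v) +
      (1/(l2+l4) - 1/(l2+l3)) * u * ((1/(l2+l3) - 1/(l3+l4)) * u) + 2 * δ) :
    ¬ IsLyapunovStable l1 l2 l3 l4 ![u, 0, 0, v, 0, 0] := by
  intro hstab
  obtain ⟨m11, m12, m21, m22, k, hk, hform⟩ := exists_form_deriv_coercive hδ hdet htr
  clear hdet htr
  obtain ⟨ε, hε, hnonpos⟩ := exists_radius_form_nonpos hk hform
  have hm : 0 < m11 ^ 2 + m21 ^ 2 := by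
    refine lt_of_le_of_ne (by positivity) fun h ↦ ?_
    have h1 : m11 = 0 :=
      pow_eq_zero_iff two_ne_zero |>.1 (le_antisymm (by linarith [sq_nonneg m21]) (sq_nonneg _))
    have h2 : m21 = 0 :=
      pow_eq_zero_iff two_ne_zero |>.1 (le_antisymm (by linarith [sq_nonneg m11]) (sq_nonneg _))
    have h3 := hform 0 0 1 0
    simp only [h1, h2] at h3
    norm_num at h3
    exact absurd hk (not_lt.2 h3)
  clear hform
  obtain ⟨η, hη, hsol⟩ := hstab ε hε
  set θ := η / (2 * (|m11| + |m21| + 1)) with hθ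
  have hθpos : 0 < θ := by positivity
  have hθη : ∀ m : ℝ, |m| ≤ |m11| + |m21| + 1 → |θ| * |m| < η := by
    intro m h
    rw [abs_of_pos hθpos]
    calc θ * |m| ≤ θ * (|m11| + |m21| + 1) := by gcongr
      _ = η / 2 := by rw [hθ]; field_simp
      _ < η := by linarith
  obtain ⟨f, hf0, hf⟩ := exists_vf_solution l1 l2 l3 l4 ![u, θ * m11, θ, v, θ * m21, 0]
  have hclose := hsol f hf (by
    rw [hf0, pi_norm_lt_iff hη]
    intro i
    have h1 := hθη m11 (by linarith [abs_nonneg m21])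
    have h2 : |θ| < η := by
      simpa using hθη 1 (by rw [abs_one]; linarith [abs_nonneg m11, abs_nonneg m21])
    have h3 := hθη m21 (by linarith [abs_nonneg m11])
    fin_cases i <;> simp [h1, h2, h3, hη.lt])
  have hcoord : ∀ i t, HasDerivAt (fun s ↦ f s i) (vf l1 l2 l3 l4 (f t) i) t :=
    fun i t ↦ hasDerivAt_pi.1 (hf t) i
  have hle := hnonpos (fun t ↦ f t 0) (fun t ↦ f t 3) (fun t ↦ f t 1) (fun t ↦ f t 4)
    (fun t ↦ f t 2) (fun t ↦ f t 5)
    (fun t ↦ (hcoord 1 t).congr_deriv (by simp [vf]; ring))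
    (fun t ↦ (hcoord 4 t).congr_deriv (by simp [vf]; ring))
    (fun t ↦ (hcoord 2 t).congr_deriv (by simp [vf]; ring))
    (fun t ↦ (hcoord 5 t).congr_deriv (by simp [vf]; ring))
    (fun t ht ↦ by
      have h := fun i ↦ (norm_le_pi_norm _ i).trans_lt (hclose t ht)
      refine ⟨?_, ?_, ?_, ?_, ?_, ?_⟩
      · simpa using h 0
      · simpa using h 3
      · simpa using h 1
      · simpa using h 4
      · simpa using h 2
      · simpa using h 5)
  simp only [hf0] at hle
  have : θ ^ 2 * (m11 ^ 2 + m21 ^ 2) ≤ 0 := by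
    refine le_trans (le_of_eq ?_) hle
    simp
    ring
  exact absurd this (not_le.2 (by positivity))

/-- for `u² < α2 v²`, `v ≠ 0` (α2 the larger root of f̃, assuming
`λ1² + λ4² ≠ λ2² + λ3²`) the equilibrium `(u,0,0,v,0,0)` is not Lyapunov stable. -/
theorem t1_bifurcation_equilibria_unstable
    (l1 l2 l3 l4 : ℝ) (h12 : l2 < l1) (h23 : l3 < l2) (h34 : l4 < l3)
    (s12 : 0 < l1 + l2) (s13 : 0 < l1 + l3) (s14 : 0 < l1 + l4)
    (s23 : 0 < l2 + l3) (s24 : 0 < l2 + l4) (s34 : 0 < l3 + l4)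
    (hne : l1 ^ 2 + l4 ^ 2 ≠ l2 ^ 2 + l3 ^ 2)
    (α1 α2 : ℝ) (hα : α1 < α2)
    (hr1 : (l1^2 - l4^2)^2 * α1 ^ 2
        - 2 * ((l1^2 - l2^2) * (l3^2 - l4^2) + (l1^2 - l3^2) * (l2^2 - l4^2)) * α1
        + (l2^2 - l3^2)^2 = 0)
    (hr2 : (l1^2 - l4^2)^2 * α2 ^ 2
        - 2 * ((l1^2 - l2^2) * (l3^2 - l4^2) + (l1^2 - l3^2) * (l2^2 - l4^2)) * α2
        + (l2^2 - l3^2)^2 = 0)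
    (u v : ℝ) (hv : v ≠ 0) (hu : u ^ 2 < α2 * v ^ 2) :
    vf l1 l2 l3 l4 ![u, 0, 0, v, 0, 0] = 0 ∧
      ¬ IsLyapunovStable l1 l2 l3 l4 ![u, 0, 0, v, 0, 0] := by
  refine ⟨?_, ?_⟩
  · ext i
    fin_cases i <;> simp [vf]
  · obtain ⟨δ, hδ, hdet, htr⟩ :=
      exists_sqrt_det_of_lt h12 h23 h34 s12 s13 s14 s23 s24 s34 hr2 hv hu
    exact not_isLyapunovStable_of_linearization hδ hdet htr
end
end

section
/- Assume λ1² + λ4² = λ2² + λ3². If u, v ∈ ℝ satisfy v ≠ 0 and u² < v², then the point e = (u, 0, 0, v, 0, 0) is an equilibrium of the so(4) free rigid body system which is not Lyapunov stable. -/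
noncomputable section

/-- A bounded, globally Lipschitz vector field on a Banach space is complete. -/
theorem exists_forall_hasDerivAt_of_lipschitz_of_bounded
    {E : Type*} [NormedAddCommGroup E] [NormedSpace ℝ E] [CompleteSpace E]
    {F : E → E} {K L : NNReal} (hK : LipschitzWith K F) (hL : ∀ x, ‖F x‖ ≤ L) (x₀ : E) :
    ∃ f : ℝ → E, f 0 = x₀ ∧ ∀ t, HasDerivAt f (F (f t)) t := by
  have local_sol : ∀ a : ℝ, ∃ α : ℝ → E, α 0 = x₀ ∧
      ∀ t ∈ Set.Ioo (-a) a, HasDerivAt α (F (α t)) t := by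
    intro a
    rcases le_or_gt a 0 with ha | ha
    · refine ⟨fun _ => x₀, rfl, fun t ht => ?_⟩
      linarith [ht.1, ht.2]
    have hpl : IsPicardLindelof (fun _ => F)
        (⟨0, by constructor <;> linarith⟩ : Set.Icc (-a) a) x₀ (L * ⟨a, ha.le⟩) 0 L K := by
      refine IsPicardLindelof.of_time_independent (fun x _ => hL x) hK.lipschitzOnWith ?_
      exact (by simp [mul_comm] : (L : ℝ) * max (a - 0) (0 - -a) ≤ (L : ℝ) * a - 0)
    obtain ⟨α, hα, hα'⟩ := hpl.exists_eq_forall_mem_Icc_hasDerivWithinAt₀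
    exact ⟨α, hα, fun t ht => (hα' t (Set.Ioo_subset_Icc_self ht)).hasDerivAt
      (Icc_mem_nhds ht.1 ht.2)⟩
  choose γ hγ0 hγ using local_sol
  have agree : ∀ a b : ℝ, a ≤ b → Set.EqOn (γ a) (γ b) (Set.Ioo (-a) a) := by
    intro a b hab t ht
    have ha : 0 < a := by linarith [ht.1, ht.2]
    exact ODE_solution_unique_of_mem_Ioo (v := fun _ => F) (s := fun _ => Set.univ) (K := K)
      (t₀ := 0) (fun _ _ => hK.lipschitzOnWith) ⟨by linarith, ha⟩
      (fun s hs => ⟨hγ a s hs, trivial⟩)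
      (fun s hs => ⟨hγ b s ⟨by linarith [hs.1], by linarith [hs.2]⟩, trivial⟩)
      (by rw [hγ0, hγ0]) ht
  refine ⟨fun t => γ (|t| + 1) t, hγ0 _, fun t => ?_⟩
  have ht : t ∈ Set.Ioo (-(|t| + 1)) (|t| + 1) := abs_lt.mp (lt_add_one _)
  refine (hγ (|t| + 1) t ht).congr_of_eventuallyEq ?_
  filter_upwards [Ioo_mem_nhds ht.1 ht.2] with s hs
  rcases le_total (|s| + 1) (|t| + 1) with h | h
  · exact agree _ _ h (abs_lt.mp (lt_add_one _))
  · exact (agree _ _ h hs).symm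

/-- The so(4) free rigid body vector field is complete. -/
theorem exists_forall_hasDerivAt_vf (l1 l2 l3 l4 : ℝ) (p₀ : Fin 6 → ℝ) :
    ∃ f : ℝ → (Fin 6 → ℝ), f 0 = p₀ ∧ ∀ t, HasDerivAt f (vf l1 l2 l3 l4 (f t)) t := by
  set N : (Fin 6 → ℝ) → ℝ := fun p => ∑ i, p i ^ 2 with hN
  set R : ℝ := N p₀ + 1 with hR
  have hN0 : ∀ p, 0 ≤ N p := fun p => Finset.sum_nonneg fun i _ => sq_nonneg _
  have hRpos : 0 < R := by linarith [hN0 p₀]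
  let χ : ContDiffBump (0 : ℝ) := ⟨R, R + 1, hRpos, by linarith⟩
  set F : (Fin 6 → ℝ) → (Fin 6 → ℝ) := fun p => χ (N p) • vf l1 l2 l3 l4 p with hF
  have hF_smooth : ContDiff ℝ 1 F := by
    have hNs : ContDiff ℝ 1 N := by fun_prop
    refine (χ.contDiff.comp hNs).smul ?_
    rw [contDiff_pi]
    intro i
    fin_cases i <;> simp only [vf] <;> simp <;> fun_prop
  have hF_supp : HasCompactSupport F := by
    refine HasCompactSupport.intro (isCompact_closedBall 0 (R + 1)) fun p hp => ?_
    have hlt : R + 1 < N p := by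
      by_contra! hle
      apply hp
      rw [mem_closedBall_zero_iff, pi_norm_le_iff_of_nonneg (by linarith)]
      intro i
      have hi : p i ^ 2 ≤ N p := Finset.single_le_sum (f := fun i => p i ^ 2)
        (fun i _ => sq_nonneg _) (Finset.mem_univ i)
      rw [Real.norm_eq_abs]
      apply abs_le_of_sq_le_sq _ (by linarith)
      nlinarith
    have hz : χ (N p) = 0 := by
      apply χ.zero_of_le_dist
      rw [Real.dist_eq, sub_zero, abs_of_nonneg (hN0 p)]
      exact hlt.le
    simp [hF, hz]
  obtain ⟨K, hK⟩ := hF_smooth.lipschitzWith_of_hasCompactSupport hF_supp one_ne_zero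
  obtain ⟨L, hL⟩ := hF_supp.exists_bound_of_continuous hF_smooth.continuous
  obtain ⟨f, hf0, hf⟩ := exists_forall_hasDerivAt_of_lipschitz_of_bounded hK
    (L := L.toNNReal) (fun x => (hL x).trans (Real.le_coe_toNNReal L)) p₀
  have hN_const : ∀ t, N (f t) = N p₀ := by
    have hd : ∀ t, HasDerivAt (fun t => N (f t)) 0 t := by
      intro t
      have hi : ∀ i, HasDerivAt (fun t => f t i) (F (f t) i) t := hasDerivAt_pi.mp (hf t)
      have h := HasDerivAt.fun_sum (u := Finset.univ) fun i _ => (hi i).pow 2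
      refine h.congr_deriv ?_
      simp [hF, vf, Fin.sum_univ_six]
      ring
    intro t
    rw [← hf0]
    exact is_const_of_deriv_eq_zero (fun t => (hd t).differentiableAt) (fun t => (hd t).deriv) t 0
  refine ⟨f, hf0, fun t => ?_⟩
  have hone : χ (N (f t)) = 1 := by
    apply χ.one_of_mem_closedBall
    rw [mem_closedBall_zero_iff, hN_const, Real.norm_eq_abs, abs_of_nonneg (hN0 _)]
    change N p₀ ≤ R
    linarith
  have h := hf t
  simpa only [hF, hone, one_smul] using h

/-- For a `2 × 2` matrix `L = !![l, m; n, o]`, the symmetric matrix `Y = (adj L)ᵀ (adj L) + det L`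
solves the Lyapunov equation `Lᵀ Y + Y L = 2 (tr L) (det L)`. Here `Y L` is evaluated as a
quadratic form. -/
theorem lyapunov_two_by_two (l m n o x y : ℝ) :
    x * ((o ^ 2 + n ^ 2 + (l * o - m * n)) * (l * x + m * y)
        - (o * m + n * l) * (n * x + o * y))
      + y * (-(o * m + n * l) * (l * x + m * y)
        + (m ^ 2 + l ^ 2 + (l * o - m * n)) * (n * x + o * y))
      = (l * o - m * n) * (l + o) * (x ^ 2 + y ^ 2) := by
  ring

/-- With `Y` as in `lyapunov_two_by_two`, the quadratic form of `Y (adj L)` is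
`(tr L) ‖(adj L) v‖²`. -/
theorem lyapunov_two_by_two_adjugate (l m n o x y : ℝ) :
    x * ((o ^ 2 + n ^ 2 + (l * o - m * n)) * (o * x - m * y)
        - (o * m + n * l) * (l * y - n * x))
      + y * (-(o * m + n * l) * (o * x - m * y)
        + (m ^ 2 + l ^ 2 + (l * o - m * n)) * (l * y - n * x))
      = (l + o) * ((o * x - m * y) ^ 2 + (l * y - n * x) ^ 2) := by
  ring

/-- An invertible `2 × 2` matrix is bounded below. -/
theorem exists_pos_mul_le_of_det_ne_zero (a b c d : ℝ) (h : a * d - b * c ≠ 0) :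
    ∃ k > 0, ∀ x y : ℝ,
      k * (x ^ 2 + y ^ 2) ≤ (a * x + b * y) ^ 2 + (c * x + d * y) ^ 2 := by
  have hS : 0 < a ^ 2 + b ^ 2 + c ^ 2 + d ^ 2 := by
    by_contra! hle
    have ha : a = 0 := by nlinarith [sq_nonneg a, sq_nonneg b, sq_nonneg c, sq_nonneg d]
    have hb : b = 0 := by nlinarith [sq_nonneg a, sq_nonneg b, sq_nonneg c, sq_nonneg d]
    simp [ha, hb] at h
  refine ⟨(a * d - b * c) ^ 2 / (a ^ 2 + b ^ 2 + c ^ 2 + d ^ 2), by positivity, fun x y => ?_⟩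
  rw [div_mul_eq_mul_div, div_le_iff₀ hS]
  have key : ((a * x + b * y) ^ 2 + (c * x + d * y) ^ 2) * (a ^ 2 + b ^ 2 + c ^ 2 + d ^ 2)
      = (a * d - b * c) ^ 2 * (x ^ 2 + y ^ 2)
        + (a * (a * x + b * y) + c * (c * x + d * y)) ^ 2
        + (b * (a * x + b * y) + d * (c * x + d * y)) ^ 2 := by
    ring
  rw [key]
  nlinarith [sq_nonneg (a * (a * x + b * y) + c * (c * x + d * y)),
    sq_nonneg (b * (a * x + b * y) + d * (c * x + d * y))]

/-- Consider the linear system `w' = P z`, `z' = Q w` on `ℝ² × ℝ²`. If `det (P Q) = Δ²` and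
`tr (P Q) + 2 Δ > 0` with `Δ > 0`, then some bilinear form `wᵀ S z` has positive definite
derivative along the system. -/
theorem exists_bilin_deriv_posDef (p₁₁ p₁₂ p₂₁ p₂₂ q₁₁ q₁₂ q₂₁ q₂₂ Δ : ℝ) (hΔ : 0 < Δ)
    (hdet : (p₁₁ * p₂₂ - p₁₂ * p₂₁) * (q₁₁ * q₂₂ - q₁₂ * q₂₁) = Δ ^ 2)
    (htr : 0 < p₁₁ * q₁₁ + p₁₂ * q₂₁ + p₂₁ * q₁₂ + p₂₂ * q₂₂ + 2 * Δ) :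
    ∃ s₁₁ s₁₂ s₂₁ s₂₂ c : ℝ, 0 < c ∧ ∀ w₁ w₂ z₁ z₂ : ℝ,
      c * (w₁ ^ 2 + w₂ ^ 2 + z₁ ^ 2 + z₂ ^ 2) ≤
        s₁₁ * ((p₁₁ * z₁ + p₁₂ * z₂) * z₁ + w₁ * (q₁₁ * w₁ + q₁₂ * w₂))
        + s₁₂ * ((p₁₁ * z₁ + p₁₂ * z₂) * z₂ + w₁ * (q₂₁ * w₁ + q₂₂ * w₂))
        + s₂₁ * ((p₂₁ * z₁ + p₂₂ * z₂) * z₁ + w₂ * (q₁₁ * w₁ + q₁₂ * w₂))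
        + s₂₂ * ((p₂₁ * z₁ + p₂₂ * z₂) * z₂ + w₂ * (q₂₁ * w₁ + q₂₂ * w₂)) := by
  obtain ⟨l, hl⟩ : ∃ l, l = p₁₁ * q₁₁ + p₁₂ * q₂₁ + Δ := ⟨_, rfl⟩
  obtain ⟨m, hm⟩ : ∃ m, m = p₁₁ * q₁₂ + p₁₂ * q₂₂ := ⟨_, rfl⟩
  obtain ⟨n, hn⟩ : ∃ n, n = p₂₁ * q₁₁ + p₂₂ * q₂₁ := ⟨_, rfl⟩
  obtain ⟨o, ho⟩ : ∃ o, o = p₂₁ * q₁₂ + p₂₂ * q₂₂ + Δ := ⟨_, rfl⟩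
  have hτ : 0 < l + o := by rw [hl, ho]; linarith
  have hD : l * o - m * n = Δ * (l + o) := by
    rw [hl, hm, hn, ho]; linear_combination hdet
  have hDpos : 0 < l * o - m * n := by rw [hD]; positivity
  have hP : p₁₁ * p₂₂ - p₁₂ * p₂₁ ≠ 0 := by
    intro h
    rw [h, zero_mul] at hdet
    exact (pow_pos hΔ 2).ne hdet
  have hKQ₁₁ : (o * p₁₁ - m * p₂₁) * q₁₁ + (o * p₁₂ - m * p₂₂) * q₂₁ = Δ * l := by
    linear_combination hD - o * hl + m * hn
  have hKQ₁₂ : (o * p₁₁ - m * p₂₁) * q₁₂ + (o * p₁₂ - m * p₂₂) * q₂₂ = Δ * m := by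
    linear_combination m * ho - o * hm
  have hKQ₂₁ : (l * p₂₁ - n * p₁₁) * q₁₁ + (l * p₂₂ - n * p₁₂) * q₂₁ = Δ * n := by
    linear_combination n * hl - l * hn
  have hKQ₂₂ : (l * p₂₁ - n * p₁₁) * q₁₂ + (l * p₂₂ - n * p₁₂) * q₂₂ = Δ * o := by
    linear_combination hD - l * ho + n * hm
  obtain ⟨k, hk, hK⟩ := exists_pos_mul_le_of_det_ne_zero
    (o * p₁₁ - m * p₂₁) (o * p₁₂ - m * p₂₂) (l * p₂₁ - n * p₁₁) (l * p₂₂ - n * p₁₂)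
    (by
      have : (o * p₁₁ - m * p₂₁) * (l * p₂₂ - n * p₁₂)
          - (o * p₁₂ - m * p₂₂) * (l * p₂₁ - n * p₁₁)
          = (l * o - m * n) * (p₁₁ * p₂₂ - p₁₂ * p₂₁) := by ring
      rw [this]
      exact mul_ne_zero hDpos.ne' hP)
  refine ⟨(o ^ 2 + n ^ 2 + (l * o - m * n)) * (o * p₁₁ - m * p₂₁)
      - (o * m + n * l) * (l * p₂₁ - n * p₁₁),
    (o ^ 2 + n ^ 2 + (l * o - m * n)) * (o * p₁₂ - m * p₂₂)
      - (o * m + n * l) * (l * p₂₂ - n * p₁₂),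
    -(o * m + n * l) * (o * p₁₁ - m * p₂₁)
      + (m ^ 2 + l ^ 2 + (l * o - m * n)) * (l * p₂₁ - n * p₁₁),
    -(o * m + n * l) * (o * p₁₂ - m * p₂₂)
      + (m ^ 2 + l ^ 2 + (l * o - m * n)) * (l * p₂₂ - n * p₁₂),
    min ((l + o) * k) (Δ * ((l * o - m * n) * (l + o))), by positivity,
    fun w₁ w₂ z₁ z₂ => ?_⟩
  have hz := lyapunov_two_by_two_adjugate l m n o (p₁₁ * z₁ + p₁₂ * z₂) (p₂₁ * z₁ + p₂₂ * z₂)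
  have hw := lyapunov_two_by_two l m n o w₁ w₂
  have hlow := mul_le_mul_of_nonneg_left (hK z₁ z₂) hτ.le
  have h₁ := mul_le_mul_of_nonneg_right
    (min_le_left ((l + o) * k) (Δ * ((l * o - m * n) * (l + o))))
    (add_nonneg (sq_nonneg z₁) (sq_nonneg z₂))
  have h₂ := mul_le_mul_of_nonneg_right
    (min_le_right ((l + o) * k) (Δ * ((l * o - m * n) * (l + o))))
    (add_nonneg (sq_nonneg w₁) (sq_nonneg w₂))
  generalize min ((l + o) * k) (Δ * ((l * o - m * n) * (l + o))) = c at *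
  have hQ₁ : (o * p₁₁ - m * p₂₁) * (q₁₁ * w₁ + q₁₂ * w₂)
      + (o * p₁₂ - m * p₂₂) * (q₂₁ * w₁ + q₂₂ * w₂) = Δ * (l * w₁ + m * w₂) := by
    linear_combination w₁ * hKQ₁₁ + w₂ * hKQ₁₂
  have hQ₂ : (l * p₂₁ - n * p₁₁) * (q₁₁ * w₁ + q₁₂ * w₂)
      + (l * p₂₂ - n * p₁₂) * (q₂₁ * w₁ + q₂₂ * w₂) = Δ * (n * w₁ + o * w₂) := by
    linear_combination w₁ * hKQ₂₁ + w₂ * hKQ₂₂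
  clear hKQ₁₁ hKQ₁₂ hKQ₂₁ hKQ₂₂ hl hm hn ho hdet htr hK
  have htotal : c * (w₁ ^ 2 + w₂ ^ 2 + z₁ ^ 2 + z₂ ^ 2) ≤
      (l + o) * (((o * p₁₁ - m * p₂₁) * z₁ + (o * p₁₂ - m * p₂₂) * z₂) ^ 2
        + ((l * p₂₁ - n * p₁₁) * z₁ + (l * p₂₂ - n * p₁₂) * z₂) ^ 2)
      + Δ * ((l * o - m * n) * (l + o)) * (w₁ ^ 2 + w₂ ^ 2) := by
    linarith
  refine htotal.trans_eq ?_
  linear_combination -hz - Δ * hw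
    - (w₁ * (o ^ 2 + n ^ 2 + (l * o - m * n)) - w₂ * (o * m + n * l)) * hQ₁
    - (w₂ * (m ^ 2 + l ^ 2 + (l * o - m * n)) - w₁ * (o * m + n * l)) * hQ₂

/-- When `λ₁² + λ₄² = λ₂² + λ₃²` and `u² < v²`, the linearization of the so(4) free rigid body
system at `(u, 0, 0, v, 0, 0)`, in the directions `x₂, y₂, x₃, y₃`, has the form
`w' = P z`, `z' = Q w` with `det (P Q) = Δ²` and `tr (P Q) + 2 Δ > 0`. -/
theorem exists_linearization_det_trace
    (l1 l2 l3 l4 : ℝ) (h12 : l2 < l1) (h23 : l3 < l2)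
    (s12 : 0 < l1 + l2) (s13 : 0 < l1 + l3) (s14 : 0 < l1 + l4)
    (s23 : 0 < l2 + l3) (s24 : 0 < l2 + l4) (s34 : 0 < l3 + l4)
    (heq : l1 ^ 2 + l4 ^ 2 = l2 ^ 2 + l3 ^ 2) (u v : ℝ) (hu : u ^ 2 < v ^ 2) :
    ∃ Δ > 0,
      (((1/(l2+l3) - 1/(l1+l2)) * u) * ((1/(l2+l3) - 1/(l3+l4)) * u)
        - ((1/(l1+l4) - 1/(l3+l4)) * v) * ((1/(l1+l4) - 1/(l1+l2)) * v))
      * (((1/(l1+l3) - 1/(l2+l3)) * u) * ((1/(l2+l4) - 1/(l2+l3)) * u)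
        - ((1/(l2+l4) - 1/(l1+l4)) * v) * ((1/(l1+l3) - 1/(l1+l4)) * v)) = Δ ^ 2 ∧
      0 < ((1/(l2+l3) - 1/(l1+l2)) * u) * ((1/(l1+l3) - 1/(l2+l3)) * u)
        + ((1/(l1+l4) - 1/(l3+l4)) * v) * ((1/(l1+l3) - 1/(l1+l4)) * v)
        + ((1/(l1+l4) - 1/(l1+l2)) * v) * ((1/(l2+l4) - 1/(l1+l4)) * v)
        + ((1/(l2+l3) - 1/(l3+l4)) * u) * ((1/(l2+l4) - 1/(l2+l3)) * u) + 2 * Δ := by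
  obtain ⟨p, hp⟩ : ∃ p, p = l1 + l2 := ⟨_, rfl⟩
  obtain ⟨q, hq⟩ : ∃ q, q = l3 + l4 := ⟨_, rfl⟩
  obtain ⟨t, ht⟩ : ∃ t, t = (l1 - l2) / q := ⟨_, rfl⟩
  have hp0 : 0 < p := hp ▸ s12
  have hq0 : 0 < q := hq ▸ s34
  have ht0 : 0 < t := by rw [ht]; exact div_pos (by linarith) hq0
  have hqt : l1 - l2 = q * t := by rw [ht]; field_simp
  have hpt : l3 - l4 = p * t := by
    apply mul_left_cancel₀ hq0.ne'
    calc q * (l3 - l4) = p * (l1 - l2) := by rw [hp, hq]; linarith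
      _ = q * (p * t) := by rw [hqt]; ring
  obtain rfl : l1 = (p + q * t) / 2 := by linarith
  obtain rfl : l2 = (p - q * t) / 2 := by linarith
  obtain rfl : l3 = (q + p * t) / 2 := by linarith
  obtain rfl : l4 = (q - p * t) / 2 := by linarith
  have e12 : (p + q * t) / 2 + (p - q * t) / 2 = p := by ring
  have e34 : (q + p * t) / 2 + (q - p * t) / 2 = q := by ring
  have e13 : (p + q * t) / 2 + (q + p * t) / 2 = (p + q) * (1 + t) / 2 := by ring
  have e24 : (p - q * t) / 2 + (q - p * t) / 2 = (p + q) * (1 - t) / 2 := by ring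
  have e14 : (p + q * t) / 2 + (q - p * t) / 2 = (p + q - t * (p - q)) / 2 := by ring
  have e23 : (p - q * t) / 2 + (q + p * t) / 2 = (p + q + t * (p - q)) / 2 := by ring
  rw [e14] at s14
  rw [e23] at s23
  rw [e24] at s24
  have h1t : 0 < 1 - t := by
    by_contra! hle
    nlinarith [mul_nonneg (add_pos hp0 hq0).le (sub_nonneg.2 hle)]
  have hpq : 0 < p - q := by nlinarith
  rw [e12, e34, e13, e24, e14, e23]
  have hX : 0 < p + q - t * (p - q) := by linarith
  have hY : 0 < p + q + t * (p - q) := by linarith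
  obtain ⟨X, hXdef⟩ : ∃ X, X = p + q - t * (p - q) := ⟨_, rfl⟩
  obtain ⟨Y, hYdef⟩ : ∃ Y, Y = p + q + t * (p - q) := ⟨_, rfl⟩
  have hXY : X ≤ Y := by rw [hXdef, hYdef]; nlinarith [mul_pos ht0 hpq]
  rw [← hXdef] at hX ⊢
  rw [← hYdef] at hY ⊢
  have hA : 0 < p + q := by positivity
  have ca : 1 / (Y / 2) - 1 / p = (p - q) * (1 - t) / (p * Y) := by
    rw [hYdef] at hY ⊢; field_simp; ring
  have cf : 1 / (Y / 2) - 1 / q = - ((p - q) * (1 + t) / (q * Y)) := by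
    rw [hYdef] at hY ⊢; field_simp; ring
  have cb : 1 / (X / 2) - 1 / q = - ((p - q) * (1 - t) / (q * X)) := by
    rw [hXdef] at hX ⊢; field_simp; ring
  have ce : 1 / (X / 2) - 1 / p = (p - q) * (1 + t) / (p * X) := by
    rw [hXdef] at hX ⊢; field_simp; ring
  have cc : 1 / ((p + q) * (1 + t) / 2) - 1 / (Y / 2)
      = - (4 * q * t / ((p + q) * (1 + t) * Y)) := by
    rw [hYdef] at hY ⊢; field_simp; ring
  have cg : 1 / ((p + q) * (1 - t) / 2) - 1 / (Y / 2) = 4 * p * t / ((p + q) * (1 - t) * Y) := by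
    rw [hYdef] at hY ⊢; field_simp; ring
  have cd : 1 / ((p + q) * (1 - t) / 2) - 1 / (X / 2) = 4 * q * t / ((p + q) * (1 - t) * X) := by
    rw [hXdef] at hX ⊢; field_simp; ring
  have ch : 1 / ((p + q) * (1 + t) / 2) - 1 / (X / 2)
      = - (4 * p * t / ((p + q) * (1 + t) * X)) := by
    rw [hXdef] at hX ⊢; field_simp; ring
  rw [ca, cf, cb, ce, cc, cg, cd, ch]
  have huv : 0 < v ^ 2 * Y ^ 2 - u ^ 2 * X ^ 2 := by
    have : u ^ 2 * X ^ 2 ≤ u ^ 2 * Y ^ 2 := by gcongr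
    linarith [mul_lt_mul_of_pos_right hu (pow_pos hY 2)]
  refine ⟨(p - q) * t / (p + q) * (4 * (v ^ 2 * Y ^ 2 - u ^ 2 * X ^ 2) / (X ^ 2 * Y ^ 2)),
    by positivity, by field_simp; ring, ?_⟩
  have htrace : (p - q) * (1 - t) / (p * Y) * u * (-(4 * q * t / ((p + q) * (1 + t) * Y)) * u)
      + -((p - q) * (1 - t) / (q * X)) * v * (-(4 * p * t / ((p + q) * (1 + t) * X)) * v)
      + (p - q) * (1 + t) / (p * X) * v * (4 * q * t / ((p + q) * (1 - t) * X) * v)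
      + -((p - q) * (1 + t) / (q * Y)) * u * (4 * p * t / ((p + q) * (1 - t) * Y) * u)
      + 2 * ((p - q) * t / (p + q) * (4 * (v ^ 2 * Y ^ 2 - u ^ 2 * X ^ 2) / (X ^ 2 * Y ^ 2)))
      = 4 * (p - q) * t * (v ^ 2 - u ^ 2) / ((p + q) * (1 - t) * (1 + t) * p * q) := by
    have hX2 : (1 - t) ^ 2 * p ^ 2 + (1 + t) ^ 2 * q ^ 2 + 2 * (1 - t) * (1 + t) * (p * q)
        = X ^ 2 := by rw [hXdef]; ring
    have hY2 : (1 + t) ^ 2 * p ^ 2 + (1 - t) ^ 2 * q ^ 2 + 2 * (1 - t) * (1 + t) * (p * q)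
        = Y ^ 2 := by rw [hYdef]; ring
    field_simp
    linear_combination v ^ 2 * Y ^ 2 * hX2 - u ^ 2 * X ^ 2 * hY2
  rw [htrace]
  have := sub_pos.2 hu
  positivity

/-- Chetaev's instability criterion for the so(4) free rigid body system. -/
theorem not_isLyapunovStable_of_chetaev {l1 l2 l3 l4 : ℝ} {e : Fin 6 → ℝ}
    {G DG : (Fin 6 → ℝ) → ℝ} {ε k M : ℝ} (hε : 0 < ε) (hk : 0 < k)
    (hderiv : ∀ f : ℝ → (Fin 6 → ℝ), (∀ t, HasDerivAt f (vf l1 l2 l3 l4 (f t)) t) →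
      ∀ t, HasDerivAt (fun s => G (f s)) (DG (f t)) t)
    (hM : ∀ p, ‖p - e‖ < ε → G p ≤ M) (hDG : ∀ p, ‖p - e‖ < ε → k * G p ≤ DG p)
    (hpos : ∀ δ > 0, ∃ p, ‖p - e‖ < δ ∧ 0 < G p) :
    ¬ IsLyapunovStable l1 l2 l3 l4 e := by
  intro hstable
  obtain ⟨δ, hδ, hstay⟩ := hstable ε hε
  obtain ⟨p, hp, hGp⟩ := hpos δ hδ
  obtain ⟨f, hf0, hf⟩ := exists_forall_hasDerivAt_vf l1 l2 l3 l4 p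
  have hball := hstay f hf (by rwa [hf0])
  have hG := hderiv f hf
  have hd : ∀ t, HasDerivAt (fun s => G (f s) * Real.exp (-k * s))
      ((DG (f t) - k * G (f t)) * Real.exp (-k * t)) t := by
    intro t
    have h₁ : HasDerivAt (fun s => Real.exp (-k * s)) (Real.exp (-k * t) * -k) t := by
      simpa using ((hasDerivAt_id t).const_mul (-k)).exp
    refine ((hG t).mul h₁).congr_deriv ?_
    ring
  have hmono : MonotoneOn (fun s => G (f s) * Real.exp (-k * s)) (Set.Ici 0) := by
    apply monotoneOn_of_deriv_nonneg (convex_Ici 0)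
    · exact fun t _ => (hd t).continuousAt.continuousWithinAt
    · exact fun t _ => (hd t).differentiableAt.differentiableWithinAt
    · intro t ht
      rw [interior_Ici] at ht
      rw [(hd t).deriv]
      exact mul_nonneg (sub_nonneg.2 (hDG _ (hball t (le_of_lt ht)))) (Real.exp_pos _).le
  have hgrow : ∀ t ≥ 0, G p * Real.exp (k * t) ≤ M := by
    intro t ht
    have h := hmono Set.self_mem_Ici ht ht
    simp only [hf0, mul_zero, Real.exp_zero, mul_one, neg_mul, Real.exp_neg] at h
    rw [← div_eq_mul_inv, le_div_iff₀ (Real.exp_pos _)] at h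
    exact h.trans (hM _ (hball t ht))
  have hMpos : 0 < M := by
    have h := hgrow 0 le_rfl
    simp only [mul_zero, Real.exp_zero, mul_one] at h
    linarith
  have h := hgrow (M / (k * G p)) (by positivity)
  have hexp := Real.add_one_le_exp (k * (M / (k * G p)))
  have hval : G p * (k * (M / (k * G p))) = M := by field_simp
  nlinarith [mul_le_mul_of_nonneg_left hexp hGp.le]

/-- A quadratic form without mixed `w`-`z` terms is bounded by a multiple of the squared norm. -/
theorem abs_quadratic_le (a b c a' b' c' w₁ w₂ z₁ z₂ : ℝ) :
    |a * w₁ ^ 2 + b * (w₁ * w₂) + c * w₂ ^ 2 + a' * z₁ ^ 2 + b' * (z₁ * z₂) + c' * z₂ ^ 2|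
      ≤ (|a| + |b| + |c| + |a'| + |b'| + |c'|) * (w₁ ^ 2 + w₂ ^ 2 + z₁ ^ 2 + z₂ ^ 2) := by
  have bound : ∀ r x N : ℝ, |x| ≤ N → |r * x| ≤ |r| * N := fun r x N h => by
    rw [abs_mul]
    exact mul_le_mul_of_nonneg_left h (abs_nonneg r)
  have ha := bound a (w₁ ^ 2) (w₁ ^ 2 + w₂ ^ 2 + z₁ ^ 2 + z₂ ^ 2)
    (by rw [abs_of_nonneg (sq_nonneg _)]; nlinarith)
  have hb := bound b (w₁ * w₂) (w₁ ^ 2 + w₂ ^ 2 + z₁ ^ 2 + z₂ ^ 2)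
    (by rw [abs_le]; constructor <;> nlinarith [sq_nonneg (w₁ + w₂), sq_nonneg (w₁ - w₂)])
  have hc := bound c (w₂ ^ 2) (w₁ ^ 2 + w₂ ^ 2 + z₁ ^ 2 + z₂ ^ 2)
    (by rw [abs_of_nonneg (sq_nonneg _)]; nlinarith)
  have ha' := bound a' (z₁ ^ 2) (w₁ ^ 2 + w₂ ^ 2 + z₁ ^ 2 + z₂ ^ 2)
    (by rw [abs_of_nonneg (sq_nonneg _)]; nlinarith)
  have hb' := bound b' (z₁ * z₂) (w₁ ^ 2 + w₂ ^ 2 + z₁ ^ 2 + z₂ ^ 2)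
    (by rw [abs_le]; constructor <;> nlinarith [sq_nonneg (z₁ + z₂), sq_nonneg (z₁ - z₂)])
  have hc' := bound c' (z₂ ^ 2) (w₁ ^ 2 + w₂ ^ 2 + z₁ ^ 2 + z₂ ^ 2)
    (by rw [abs_of_nonneg (sq_nonneg _)]; nlinarith)
  rw [abs_le] at *
  constructor <;> linarith

/-- A bilinear form `wᵀ S z` is bounded by a multiple of the squared norm. -/
theorem bilin_le (s₁₁ s₁₂ s₂₁ s₂₂ w₁ w₂ z₁ z₂ : ℝ) :
    s₁₁ * (w₁ * z₁) + s₁₂ * (w₁ * z₂) + s₂₁ * (w₂ * z₁) + s₂₂ * (w₂ * z₂)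
      ≤ (|s₁₁| + |s₁₂| + |s₂₁| + |s₂₂|) * (w₁ ^ 2 + w₂ ^ 2 + z₁ ^ 2 + z₂ ^ 2) := by
  have bound : ∀ s x y N : ℝ, x ^ 2 + y ^ 2 ≤ N → s * (x * y) ≤ |s| * N := fun s x y N h => by
    refine (le_abs_self _).trans ?_
    rw [abs_mul]
    refine mul_le_mul_of_nonneg_left ?_ (abs_nonneg s)
    rw [abs_le]
    constructor <;> nlinarith [sq_nonneg (x + y), sq_nonneg (x - y)]
  have h₁₁ := bound s₁₁ w₁ z₁ (w₁ ^ 2 + w₂ ^ 2 + z₁ ^ 2 + z₂ ^ 2) (by nlinarith)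
  have h₁₂ := bound s₁₂ w₁ z₂ (w₁ ^ 2 + w₂ ^ 2 + z₁ ^ 2 + z₂ ^ 2) (by nlinarith)
  have h₂₁ := bound s₂₁ w₂ z₁ (w₁ ^ 2 + w₂ ^ 2 + z₁ ^ 2 + z₂ ^ 2) (by nlinarith)
  have h₂₂ := bound s₂₂ w₂ z₂ (w₁ ^ 2 + w₂ ^ 2 + z₁ ^ 2 + z₂ ^ 2) (by nlinarith)
  linarith

/-- when `λ1² + λ4² = λ2² + λ3²`, the equilibrium `(u,0,0,v,0,0)` with
`v ≠ 0` and `u² < v²` is not Lyapunov stable. -/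
theorem t1_degenerate_case_unstable
    (l1 l2 l3 l4 : ℝ) (h12 : l2 < l1) (h23 : l3 < l2) (h34 : l4 < l3)
    (s12 : 0 < l1 + l2) (s13 : 0 < l1 + l3) (s14 : 0 < l1 + l4)
    (s23 : 0 < l2 + l3) (s24 : 0 < l2 + l4) (s34 : 0 < l3 + l4)
    (heq : l1 ^ 2 + l4 ^ 2 = l2 ^ 2 + l3 ^ 2)
    (u v : ℝ) (hv : v ≠ 0) (hu : u ^ 2 < v ^ 2) :
    vf l1 l2 l3 l4 ![u, 0, 0, v, 0, 0] = 0 ∧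
      ¬ IsLyapunovStable l1 l2 l3 l4 ![u, 0, 0, v, 0, 0] := by
  refine ⟨by ext i; fin_cases i <;> simp [vf], ?_⟩
  obtain ⟨Δ, hΔ, hdet, htr⟩ := exists_linearization_det_trace l1 l2 l3 l4 h12 h23
    s12 s13 s14 s23 s24 s34 heq u v hu
  obtain ⟨s₁₁, s₁₂, s₂₁, s₂₂, κ, hκ, hlin⟩ :=
    exists_bilin_deriv_posDef _ _ _ _ _ _ _ _ Δ hΔ hdet (by linarith)
  obtain ⟨a, ha⟩ : ∃ a, a = 1/(l2+l3) - 1/(l1+l2) := ⟨_, rfl⟩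
  obtain ⟨b, hb⟩ : ∃ b, b = 1/(l1+l4) - 1/(l3+l4) := ⟨_, rfl⟩
  obtain ⟨c, hc⟩ : ∃ c, c = 1/(l1+l3) - 1/(l2+l3) := ⟨_, rfl⟩
  obtain ⟨d, hd⟩ : ∃ d, d = 1/(l2+l4) - 1/(l1+l4) := ⟨_, rfl⟩
  obtain ⟨e, he⟩ : ∃ e, e = 1/(l1+l4) - 1/(l1+l2) := ⟨_, rfl⟩
  obtain ⟨f, hf⟩ : ∃ f, f = 1/(l2+l3) - 1/(l3+l4) := ⟨_, rfl⟩
  obtain ⟨g, hg⟩ : ∃ g, g = 1/(l2+l4) - 1/(l2+l3) := ⟨_, rfl⟩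
  obtain ⟨h, hh⟩ : ∃ h, h = 1/(l1+l3) - 1/(l1+l4) := ⟨_, rfl⟩
  rw [← ha, ← hb, ← hc, ← hd, ← he, ← hf, ← hg, ← hh] at hlin
  set n : (Fin 6 → ℝ) → ℝ := fun p => p 1 ^ 2 + p 4 ^ 2 + p 2 ^ 2 + p 5 ^ 2 with hn
  set G : (Fin 6 → ℝ) → ℝ := fun p =>
    s₁₁ * (p 1 * p 2) + s₁₂ * (p 1 * p 5) + s₂₁ * (p 4 * p 2) + s₂₂ * (p 4 * p 5) with hG
  set Φ : (Fin 6 → ℝ) → ℝ := fun p =>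
    (s₁₁ * c) * p 1 ^ 2 + (s₁₂ * g + s₂₁ * c) * (p 1 * p 4) + (s₂₂ * g) * p 4 ^ 2
      + (s₁₁ * a) * p 2 ^ 2 + (s₁₂ * a + s₂₁ * f) * (p 2 * p 5) + (s₂₂ * f) * p 5 ^ 2 with hΦ
  set Ψ : (Fin 6 → ℝ) → ℝ := fun p =>
    (s₁₂ * h) * p 1 ^ 2 + (s₁₁ * d + s₂₂ * h) * (p 1 * p 4) + (s₂₁ * d) * p 4 ^ 2
      + (s₂₁ * e) * p 2 ^ 2 + (s₁₁ * b + s₂₂ * e) * (p 2 * p 5) + (s₁₂ * b) * p 5 ^ 2 with hΨ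
  have hn0 : ∀ p, 0 ≤ n p := fun p => by positivity
  have hlinΦΨ : ∀ p, κ * n p ≤ u * Φ p + v * Ψ p := fun p => by
    refine (hlin (p 1) (p 4) (p 2) (p 5)).trans_eq ?_
    simp only [hΦ, hΨ]
    ring
  obtain ⟨C, hC0, hΦC, hΨC⟩ :
      ∃ C > 0, (∀ p, |Φ p| ≤ C * n p) ∧ ∀ p, |Ψ p| ≤ C * n p := by
    obtain ⟨C₁, h₁⟩ : ∃ C₁, ∀ p, |Φ p| ≤ C₁ * n p := ⟨_, fun p => abs_quadratic_le ..⟩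
    obtain ⟨C₂, h₂⟩ : ∃ C₂, ∀ p, |Ψ p| ≤ C₂ * n p := ⟨_, fun p => abs_quadratic_le ..⟩
    refine ⟨max 1 (max C₁ C₂), by positivity, fun p => (h₁ p).trans ?_, fun p => (h₂ p).trans ?_⟩
    · exact mul_le_mul_of_nonneg_right (by simp) (hn0 p)
    · exact mul_le_mul_of_nonneg_right (by simp) (hn0 p)
  obtain ⟨S, hS0, hGS⟩ : ∃ S > 0, ∀ p, G p ≤ S * n p := by
    refine ⟨|s₁₁| + |s₁₂| + |s₂₁| + |s₂₂| + 1, by positivity, fun p => ?_⟩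
    linarith [bilin_le s₁₁ s₁₂ s₂₁ s₂₂ (p 1) (p 4) (p 2) (p 5), hn0 p]
  have hcoord : ∀ (p : Fin 6 → ℝ) (r : ℝ), ‖p - ![u, 0, 0, v, 0, 0]‖ < r →
      |p 0 - u| < r ∧ |p 1| < r ∧ |p 2| < r ∧ |p 3 - v| < r ∧ |p 4| < r ∧ |p 5| < r := by
    intro p r hp
    have hi := fun i => (norm_le_pi_norm (p - ![u, 0, 0, v, 0, 0]) i).trans_lt hp
    refine ⟨?_, ?_, ?_, ?_, ?_, ?_⟩
    · simpa using hi 0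
    · simpa using hi 1
    · simpa using hi 2
    · simpa using hi 3
    · simpa using hi 4
    · simpa using hi 5
  set ε : ℝ := κ / (4 * C) with hε
  refine not_isLyapunovStable_of_chetaev (G := G) (DG := fun p => p 0 * Φ p + p 3 * Ψ p)
    (ε := ε) (k := κ / (2 * S)) (M := S * (4 * ε ^ 2)) (by positivity) (by positivity) ?_ ?_ ?_ ?_
  · intro x hx t
    have hi : ∀ i, HasDerivAt (fun t => x t i) (vf l1 l2 l3 l4 (x t) i) t :=
      hasDerivAt_pi.mp (hx t)
    have hprod := ((((hi 1).mul (hi 2)).const_mul s₁₁).add (((hi 1).mul (hi 5)).const_mul s₁₂)).add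
      (((hi 4).mul (hi 2)).const_mul s₂₁) |>.add (((hi 4).mul (hi 5)).const_mul s₂₂)
    refine hprod.congr_deriv ?_
    simp only [hΦ, hΨ, ha, hb, hc, hd, he, hf, hg, hh]
    simp [vf]
    ring
  · intro p hp
    obtain ⟨-, h1, h2, -, h4, h5⟩ := hcoord p ε hp
    refine (hGS p).trans (mul_le_mul_of_nonneg_left ?_ hS0.le)
    have hsq : ∀ y : ℝ, |y| < ε → y ^ 2 ≤ ε ^ 2 := fun y hy => by
      rw [← sq_abs]
      exact pow_le_pow_left₀ (abs_nonneg y) hy.le 2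
    linarith [hsq _ h1, hsq _ h2, hsq _ h4, hsq _ h5]
  · intro p hp
    obtain ⟨h0, -, -, h3, -, -⟩ := hcoord p ε hp
    have hperturb : ∀ y F : ℝ, |y| < ε → |F| ≤ C * n p → -(κ / 4 * n p) ≤ y * F := by
      intro y F hy hF
      have hle : |y * F| ≤ ε * (C * n p) := by
        rw [abs_mul]
        exact mul_le_mul hy.le hF (abs_nonneg F) (by positivity)
      have hεC : ε * (C * n p) = κ / 4 * n p := by
        rw [hε]; field_simp
      rw [hεC] at hle
      exact (abs_le.mp hle).1
    have hGn : κ / (2 * S) * G p ≤ κ / 2 * n p := by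
      calc κ / (2 * S) * G p ≤ κ / (2 * S) * (S * n p) :=
            mul_le_mul_of_nonneg_left (hGS p) (by positivity)
        _ = κ / 2 * n p := by field_simp
    have hp0 := hperturb _ _ h0 (hΦC p)
    have hp3 := hperturb _ _ h3 (hΨC p)
    have hl := hlinΦΨ p
    linarith
  · obtain ⟨q, hq⟩ : ∃ q : Fin 6 → ℝ, 0 < G q := by
      by_contra! hle
      have hs : s₁₁ = 0 ∧ s₁₂ = 0 ∧ s₂₁ = 0 ∧ s₂₂ = 0 := by
        refine ⟨le_antisymm ?_ ?_, le_antisymm ?_ ?_, le_antisymm ?_ ?_, le_antisymm ?_ ?_⟩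
        · simpa [hG] using hle ![0, 1, 1, 0, 0, 0]
        · simpa [hG] using hle ![0, 1, -1, 0, 0, 0]
        · simpa [hG] using hle ![0, 1, 0, 0, 0, 1]
        · simpa [hG] using hle ![0, 1, 0, 0, 0, -1]
        · simpa [hG] using hle ![0, 0, 1, 0, 1, 0]
        · simpa [hG] using hle ![0, 0, -1, 0, 1, 0]
        · simpa [hG] using hle ![0, 0, 0, 0, 1, 1]
        · simpa [hG] using hle ![0, 0, 0, 0, 1, -1]
      obtain ⟨rfl, rfl, rfl, rfl⟩ := hs
      have h1 := hlin 1 0 0 0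
      simp at h1
      linarith
    intro δ hδ
    set r : Fin 6 → ℝ := ![0, q 1, q 2, 0, q 4, q 5] with hr
    set η : ℝ := δ / (2 * (‖r‖ + 1)) with hη
    have hη0 : 0 < η := by positivity
    refine ⟨![u, 0, 0, v, 0, 0] + η • r, ?_, ?_⟩
    · rw [add_sub_cancel_left, norm_smul, Real.norm_of_nonneg hη0.le]
      calc η * ‖r‖ ≤ η * (‖r‖ + 1) := by gcongr; linarith
        _ = δ / 2 := by rw [hη]; field_simp
        _ < δ := by linarith
    · have : G (![u, 0, 0, v, 0, 0] + η • r) = η ^ 2 * G q := by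
        simp [hG, hr]
        ring
      rw [this]
      positivity
end
end

section
/- If u, v ∈ ℝ satisfy u² ≠ v², then the point e = (0, u, 0, 0, v, 0) is an equilibrium of the so(4) free rigid body system which is not Lyapunov stable. -/
noncomputable section

/-- Normalized eigenvectors: with `e = (0, u, 0, 0, v, 0)` off the degenerate lines, there is
a vector `w = (x1, 0, x3, y1, 0, y3)` that is an eigenvector of the linearization at `e` with eigenvalue
`μ ≠ 0` and satisfies `vf w = -μ e`. -/
lemma exists_normalized_eigenvector
    (l1 l2 l3 l4 : ℝ) (h12 : l2 < l1) (h23 : l3 < l2) (h34 : l4 < l3)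
    (s12 : 0 < l1 + l2) (s13 : 0 < l1 + l3) (s14 : 0 < l1 + l4)
    (s23 : 0 < l2 + l3) (s24 : 0 < l2 + l4) (s34 : 0 < l3 + l4)
    (u v : ℝ) (huv : (l2 + l4) ^ 2 * u ^ 2 ≠ (l1 + l3) ^ 2 * v ^ 2) :
    ∃ x1 x3 y1 y3 μ : ℝ, μ ≠ 0 ∧
      (1/(l1+l2) - 1/(l1+l3)) * (u * x3) + (1/(l3+l4) - 1/(l2+l4)) * (v * y3) = μ * x1 ∧
      (1/(l2+l3) - 1/(l1+l2)) * (x1 * x3) + (1/(l1+l4) - 1/(l3+l4)) * (y1 * y3) = -μ * u ∧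
      (1/(l1+l3) - 1/(l2+l3)) * (x1 * u) + (1/(l2+l4) - 1/(l1+l4)) * (y1 * v) = μ * x3 ∧
      (1/(l3+l4) - 1/(l1+l3)) * (u * y3) + (1/(l1+l2) - 1/(l2+l4)) * (x3 * v) = μ * y1 ∧
      (1/(l2+l3) - 1/(l3+l4)) * (x1 * y3) + (1/(l1+l4) - 1/(l1+l2)) * (x3 * y1) = -μ * v ∧
      (1/(l2+l4) - 1/(l2+l3)) * (x1 * v) + (1/(l1+l3) - 1/(l1+l4)) * (u * y1) = μ * y3 := by
  have d12 : 0 < l1 - l2 := by linarith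
  have d13 : 0 < l1 - l3 := by linarith
  have d14 : 0 < l1 - l4 := by linarith
  have d23 : 0 < l2 - l3 := by linarith
  have d24 : 0 < l2 - l4 := by linarith
  have d34 : 0 < l3 - l4 := by linarith
  obtain ⟨y, ⟨hy0, hy1⟩, hy⟩ : ∃ y ∈ Set.Icc 0 ((l2-l3)*(l2+l3)/((l3-l4)*(l3+l4))),
      ((l2-l4)*(l2+l4))^2 * y * u^2 - v^2 * ((l2-l3)*(l2+l3) - (l3-l4)*(l3+l4)*y)
        * ((l1-l2)*(l1+l2) + (l1-l4)*(l1+l4)*y) = 0 := by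
    have hc : ContinuousOn (fun y : ℝ => ((l2-l4)*(l2+l4))^2 * y * u^2
        - v^2 * ((l2-l3)*(l2+l3) - (l3-l4)*(l3+l4)*y)
        * ((l1-l2)*(l1+l2) + (l1-l4)*(l1+l4)*y))
        (Set.Icc 0 ((l2-l3)*(l2+l3)/((l3-l4)*(l3+l4)))) := by fun_prop
    refine intermediate_value_Icc (by positivity) hc ⟨?_, ?_⟩
    · have : 0 ≤ v^2 * ((l2-l3)*(l2+l3)) * ((l1-l2)*(l1+l2)) := by positivity
      simpa using this
    · have e : (l3-l4)*(l3+l4)*((l2-l3)*(l2+l3)/((l3-l4)*(l3+l4))) = (l2-l3)*(l2+l3) := by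
        field_simp
      simp only [e, sub_self, mul_zero, zero_mul, sub_zero]
      positivity
  have hB : 0 < (l1-l2)*(l1+l2) + (l1-l4)*(l1+l4)*y := by positivity
  have hD : 0 < (l1-l3)*(l1+l3) := by positivity
  obtain ⟨b, hb, hb2⟩ : ∃ b : ℝ, 0 < b ∧ b^2 = (l1-l2)*(l1+l2) + (l1-l4)*(l1+l4)*y :=
    ⟨_, Real.sqrt_pos.2 hB, Real.sq_sqrt hB.le⟩
  obtain ⟨h, hh, hh2⟩ : ∃ h : ℝ, 0 < h ∧ h^2 = (l1-l3)*(l1+l3) :=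
    ⟨_, Real.sqrt_pos.2 hD, Real.sq_sqrt hD.le⟩
  rw [← hb2] at hy
  have huv0 : u ≠ 0 ∨ v ≠ 0 := by
    by_contra! hc
    exact huv (by rw [hc.1, hc.2]; ring)
  have hN : 0 < (u^2 + (l3-l4)*(l3+l4)*v^2*b^2/((l2-l4)*(l2+l4))^2)
      / ((l2-l3)*(l2+l3)*h^2) := by
    rcases huv0 with hu | hv <;> positivity
  obtain ⟨β, hβ, hβ2⟩ : ∃ β : ℝ, 0 < β ∧ β^2 =
      (u^2 + (l3-l4)*(l3+l4)*v^2*b^2/((l2-l4)*(l2+l4))^2) / ((l2-l3)*(l2+l3)*h^2) :=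
    ⟨_, Real.sqrt_pos.2 hN, Real.sq_sqrt hN.le⟩
  have hβ3 : β^2 * ((l2-l3)*(l2+l3)*h^2) * ((l2-l4)*(l2+l4))^2
      = ((l2-l4)*(l2+l4))^2*u^2 + (l3-l4)*(l3+l4)*v^2*b^2 := by
    rw [hβ2]; field_simp
  obtain ⟨γ, hγ⟩ : ∃ γ, γ = u / (h * b) := ⟨_, rfl⟩
  obtain ⟨δ, hδ⟩ : ∃ δ, δ = v * b / ((l2-l4)*(l2+l4) * β * h) := ⟨_, rfl⟩
  have hu : u = h * b * γ := by rw [hγ]; field_simp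
  have hv : v = (l2-l4)*(l2+l4) * δ * β * h / b := by rw [hδ]; field_simp
  have hA : ((l2-l3)*(l2+l3) - (l3-l4)*(l3+l4)*y) * h^2 * β^2 = u^2 := by
    have : (l2-l3)*(l2+l3) * ((l2-l4)*(l2+l4))^2 ≠ 0 := by positivity
    apply mul_left_cancel₀ this
    linear_combination ((l2-l3)*(l2+l3) - (l3-l4)*(l3+l4)*y) * hβ3 - (l3-l4)*(l3+l4) * hy
  have hV : ((l2-l4)*(l2+l4))^2 * y * h^2 * β^2 = v^2 * b^2 := by
    have : (l2-l3)*(l2+l3) ≠ 0 := by positivity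
    apply mul_left_cancel₀ this
    linear_combination y * hβ3 + hy
  have hδ2 : δ^2 = y := by
    rw [hδ, div_pow, div_eq_iff (by positivity)]
    linear_combination -hV
  have hγ2 : γ^2 * b^2 = β^2 * ((l2-l3)*(l2+l3) - (l3-l4)*(l3+l4)*δ^2) := by
    rw [hγ, hδ2]; field_simp
    linear_combination -hA
  rw [← hδ2] at hb2
  obtain ⟨M, hM⟩ : ∃ M, M = (l2-l3)*(l1-l2) - δ^2*((l3-l4)*(l1-l4)) := ⟨_, rfl⟩
  have i1 : 1/(l1+l2) - 1/(l1+l3) = -(l2-l3)/((l1+l2)*(l1+l3)) := by field_simp; ring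
  have i2 : 1/(l3+l4) - 1/(l2+l4) = (l2-l3)/((l3+l4)*(l2+l4)) := by field_simp; ring
  have i3 : 1/(l2+l3) - 1/(l1+l2) = (l1-l3)/((l2+l3)*(l1+l2)) := by field_simp; ring
  have i4 : 1/(l1+l4) - 1/(l3+l4) = -(l1-l3)/((l1+l4)*(l3+l4)) := by field_simp; ring
  have i5 : 1/(l1+l3) - 1/(l2+l3) = -(l1-l2)/((l1+l3)*(l2+l3)) := by field_simp; ring
  have i6 : 1/(l2+l4) - 1/(l1+l4) = (l1-l2)/((l2+l4)*(l1+l4)) := by field_simp; ring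
  have i7 : 1/(l3+l4) - 1/(l1+l3) = (l1-l4)/((l3+l4)*(l1+l3)) := by field_simp; ring
  have i8 : 1/(l1+l2) - 1/(l2+l4) = -(l1-l4)/((l1+l2)*(l2+l4)) := by field_simp; ring
  have i9 : 1/(l2+l3) - 1/(l3+l4) = -(l2-l4)/((l2+l3)*(l3+l4)) := by field_simp; ring
  have i10 : 1/(l1+l4) - 1/(l1+l2) = (l2-l4)/((l1+l4)*(l1+l2)) := by field_simp; ring
  have i11 : 1/(l2+l4) - 1/(l2+l3) = (l3-l4)/((l2+l4)*(l2+l3)) := by field_simp; ring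
  have i12 : 1/(l1+l3) - 1/(l1+l4) = -(l3-l4)/((l1+l3)*(l1+l4)) := by field_simp; ring
  rw [i1, i2, i3, i4, i5, i6, i7, i8, i9, i10, i11, i12]
  have hM0 : M ≠ 0 := by
    intro h0
    rw [h0] at hM
    have e1 : (l1-l4) * ((l2-l3)*(l2+l3) - (l3-l4)*(l3+l4)*δ^2)
        = (l2-l3)*((l1+l3)*(l2-l4)) := by
      linear_combination -(l3+l4) * hM
    have e2 : (l3-l4) * b^2 = (l1-l2)*((l1+l3)*(l2-l4)) := by
      linear_combination (l3-l4) * hb2 + (l1+l4) * hM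
    have e3 : ((l2-l3)*(l2+l3) - (l3-l4)*(l3+l4)*δ^2) * b^2
        = (l1+l3)^2*(l2-l4)^2*δ^2 := by
      have : (l1-l4)*(l3-l4) ≠ 0 := by positivity
      apply mul_left_cancel₀ this
      linear_combination (l3-l4) * b^2 * e1 + (l2-l3)*((l1+l3)*(l2-l4)) * e2
        - (l1+l3)^2*(l2-l4)^2 * hM
    rw [hδ2] at e3
    apply huv
    have : b^2 ≠ 0 := by positivity
    apply mul_left_cancel₀ this
    linear_combination -(l2+l4)^2 * b^2 * hA + (l1+l3)^2 * hV + (l2+l4)^2 * h^2 * β^2 * e3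
  refine ⟨β*((l2-l3)*(l2+l3)), γ*((l1-l2)*(l1+l2)), γ*δ*((l1-l4)*(l1+l4)),
    β*δ*((l3-l4)*(l3+l4)), -(h*β*M/(b*(l1+l3))), ?_, ?_, ?_, ?_, ?_, ?_, ?_⟩
  · exact neg_ne_zero.2 (by positivity)
  · rw [hu, hv, hM]; field_simp
    linear_combination -(l1-l2) * hγ2
  · rw [hu, hM]; field_simp
    linear_combination -γ * ((l2-l3)*(l1-l2) - δ^2*(l1-l4)*(l3-l4)) * hh2
  · rw [hu, hv, hM]; field_simp
    linear_combination -γ * (l2-l3) * hb2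
  · rw [hu, hv, hM]; field_simp
    linear_combination γ * δ * (l3-l4) * hb2
  · rw [hv, hM]; field_simp
    linear_combination δ * (l1+l3) * (l1-l2) * (l1-l4) * hγ2
      - δ * β^2 * (l2-l3) * (l3-l4) * (l1+l3) * hb2
      - β^2 * δ * ((l2-l3)*(l1-l2) - δ^2*(l3-l4)*(l1-l4)) * (l2+l4) * hh2
  · rw [hu, hv, hM]; field_simp
    linear_combination -δ * (l1-l4) * hγ2

lemma tendsto_inv_cosh_atTop : Filter.Tendsto (fun t => (Real.cosh t)⁻¹) Filter.atTop (nhds 0) := by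
  refine Filter.Tendsto.inv_tendsto_atTop ?_
  refine Filter.tendsto_atTop_mono (fun t => ?_)
    (Real.tendsto_exp_atTop.atTop_div_const (two_pos))
  rw [Real.cosh_eq]
  linarith [Real.exp_pos (-t)]

lemma tendsto_tanh_atTop : Filter.Tendsto Real.tanh Filter.atTop (nhds 1) := by
  have h : ∀ t, Real.tanh t = 1 - Real.exp (-t) * (Real.cosh t)⁻¹ := fun t => by
    rw [Real.tanh_eq_sinh_div_cosh, ← Real.cosh_sub_sinh]
    have := (Real.cosh_pos t).ne'
    field_simp
    ring
  have := (Real.tendsto_exp_neg_atTop_nhds_zero.mul tendsto_inv_cosh_atTop).const_sub 1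
  rw [funext h]
  simpa using this

lemma tendsto_inv_cosh_atBot : Filter.Tendsto (fun t => (Real.cosh t)⁻¹) Filter.atBot (nhds 0) := by
  simpa [Function.comp_def] using tendsto_inv_cosh_atTop.comp Filter.tendsto_neg_atBot_atTop

lemma tendsto_tanh_atBot : Filter.Tendsto Real.tanh Filter.atBot (nhds (-1)) := by
  simpa [Function.comp_def] using (tendsto_tanh_atTop.comp Filter.tendsto_neg_atBot_atTop).neg

/-- Off the degenerate lines, there is a solution joining `(0, u, 0, 0, v, 0)` to its opposite. -/
lemma exists_heteroclinic_solution
    (l1 l2 l3 l4 : ℝ) (h12 : l2 < l1) (h23 : l3 < l2) (h34 : l4 < l3)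
    (s12 : 0 < l1 + l2) (s13 : 0 < l1 + l3) (s14 : 0 < l1 + l4)
    (s23 : 0 < l2 + l3) (s24 : 0 < l2 + l4) (s34 : 0 < l3 + l4)
    (u v : ℝ) (huv : (l2 + l4) ^ 2 * u ^ 2 ≠ (l1 + l3) ^ 2 * v ^ 2) :
    ∃ f : ℝ → Fin 6 → ℝ, (∀ t, HasDerivAt f (vf l1 l2 l3 l4 (f t)) t) ∧
      Filter.Tendsto f Filter.atBot (nhds ![0, u, 0, 0, v, 0]) ∧
      Filter.Tendsto f Filter.atTop (nhds (-![0, u, 0, 0, v, 0])) := by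
  obtain ⟨x1, x3, y1, y3, μ, hμ, e1, e2, e3, e4, e5, e6⟩ : ∃ x1 x3 y1 y3 μ : ℝ, 0 < μ ∧
      (1/(l1+l2) - 1/(l1+l3)) * (u * x3) + (1/(l3+l4) - 1/(l2+l4)) * (v * y3) = μ * x1 ∧
      (1/(l2+l3) - 1/(l1+l2)) * (x1 * x3) + (1/(l1+l4) - 1/(l3+l4)) * (y1 * y3) = -μ * u ∧
      (1/(l1+l3) - 1/(l2+l3)) * (x1 * u) + (1/(l2+l4) - 1/(l1+l4)) * (y1 * v) = μ * x3 ∧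
      (1/(l3+l4) - 1/(l1+l3)) * (u * y3) + (1/(l1+l2) - 1/(l2+l4)) * (x3 * v) = μ * y1 ∧
      (1/(l2+l3) - 1/(l3+l4)) * (x1 * y3) + (1/(l1+l4) - 1/(l1+l2)) * (x3 * y1) = -μ * v ∧
      (1/(l2+l4) - 1/(l2+l3)) * (x1 * v) + (1/(l1+l3) - 1/(l1+l4)) * (u * y1) = μ * y3 := by
    obtain ⟨x1, x3, y1, y3, μ, hμ, e1, e2, e3, e4, e5, e6⟩ :=
      exists_normalized_eigenvector l1 l2 l3 l4 h12 h23 h34 s12 s13 s14 s23 s24 s34 u v huv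
    rcases hμ.lt_or_gt with hμ | hμ
    · exact ⟨x1, -x3, y1, -y3, -μ, neg_pos.2 hμ, by linear_combination -e1,
        by linear_combination -e2, by linear_combination e3, by linear_combination -e4,
        by linear_combination -e5, by linear_combination e6⟩
    · exact ⟨x1, x3, y1, y3, μ, hμ, e1, e2, e3, e4, e5, e6⟩
  have hf : (fun t => (Real.cosh (μ * t))⁻¹ • ![x1, 0, x3, y1, 0, y3]
      - Real.tanh (μ * t) • ![0, u, 0, 0, v, 0]) = fun t => ![(Real.cosh (μ * t))⁻¹ * x1,
        -(Real.tanh (μ * t) * u), (Real.cosh (μ * t))⁻¹ * x3, (Real.cosh (μ * t))⁻¹ * y1,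
        -(Real.tanh (μ * t) * v), (Real.cosh (μ * t))⁻¹ * y3] := by
    ext t i
    fin_cases i <;> simp
  refine ⟨fun t => (Real.cosh (μ * t))⁻¹ • ![x1, 0, x3, y1, 0, y3]
      - Real.tanh (μ * t) • ![0, u, 0, 0, v, 0], ?_, ?_, ?_⟩
  · intro t
    rw [hf]
    have hc := (Real.cosh_pos (μ * t)).ne'
    have hl : HasDerivAt (fun t => μ * t) μ t := by simpa using (hasDerivAt_id t).const_mul μ
    have hS : HasDerivAt (fun t => (Real.cosh (μ * t))⁻¹)
        (-μ * ((Real.cosh (μ * t))⁻¹ * Real.tanh (μ * t))) t := by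
      refine (hl.cosh.inv hc).congr_deriv ?_
      rw [Real.tanh_eq_sinh_div_cosh]
      field_simp
    have hT : HasDerivAt (fun t => Real.tanh (μ * t)) (μ * ((Real.cosh (μ * t))⁻¹) ^ 2) t := by
      simp only [Real.tanh_eq_sinh_div_cosh]
      refine (hl.sinh.div hl.cosh hc).congr_deriv ?_
      field_simp
      linear_combination Real.cosh_sq_sub_sinh_sq (μ * t)
    refine hasDerivAt_pi.2 fun i => ?_
    fin_cases i
    · refine (hS.mul_const x1).congr_deriv ?_
      simp [vf]
      linear_combination (Real.cosh (μ * t))⁻¹ * Real.tanh (μ * t) * e1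
    · refine (hT.mul_const u).neg.congr_deriv ?_
      simp [vf]
      linear_combination -(Real.cosh (μ * t))⁻¹ ^ 2 * e2
    · refine (hS.mul_const x3).congr_deriv ?_
      simp [vf]
      linear_combination (Real.cosh (μ * t))⁻¹ * Real.tanh (μ * t) * e3
    · refine (hS.mul_const y1).congr_deriv ?_
      simp [vf]
      linear_combination (Real.cosh (μ * t))⁻¹ * Real.tanh (μ * t) * e4
    · refine (hT.mul_const v).neg.congr_deriv ?_
      simp [vf]
      linear_combination -(Real.cosh (μ * t))⁻¹ ^ 2 * e5
    · refine (hS.mul_const y3).congr_deriv ?_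
      simp [vf]
      linear_combination (Real.cosh (μ * t))⁻¹ * Real.tanh (μ * t) * e6
  · have hl : Filter.Tendsto (fun t => μ * t) Filter.atBot Filter.atBot :=
      Filter.tendsto_id.const_mul_atBot hμ
    simpa using ((tendsto_inv_cosh_atBot.comp hl).smul_const ![x1, 0, x3, y1, 0, y3]).sub
      ((tendsto_tanh_atBot.comp hl).smul_const ![0, u, 0, 0, v, 0])
  · have hl : Filter.Tendsto (fun t => μ * t) Filter.atTop Filter.atTop :=
      Filter.tendsto_id.const_mul_atTop hμ
    simpa using ((tendsto_inv_cosh_atTop.comp hl).smul_const ![x1, 0, x3, y1, 0, y3]).sub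
      ((tendsto_tanh_atTop.comp hl).smul_const ![0, u, 0, 0, v, 0])

/-- A heteroclinic solution from a point close to `e` to the opposite point obstructs the
stability of `e`. -/
lemma not_isLyapunovStable_of_heteroclinic (l1 l2 l3 l4 : ℝ) (e : Fin 6 → ℝ) (he : e ≠ 0)
    (H : ∀ δ > 0, ∃ e', ‖e' - e‖ < δ ∧ ∃ f : ℝ → Fin 6 → ℝ,
      (∀ t, HasDerivAt f (vf l1 l2 l3 l4 (f t)) t) ∧
      Filter.Tendsto f Filter.atBot (nhds e') ∧ Filter.Tendsto f Filter.atTop (nhds (-e'))) :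
    ¬ IsLyapunovStable l1 l2 l3 l4 e := by
  intro hs
  have hn : 0 < ‖e‖ := norm_pos_iff.2 he
  obtain ⟨δ, hδ, hst⟩ := hs ‖e‖ hn
  obtain ⟨e', he', f, hf, hbot, htop⟩ := H (min δ ‖e‖) (lt_min hδ hn)
  have hstart : ∀ᶠ t in Filter.atBot, ‖f t - e‖ < δ :=
    (hbot.sub_const e).norm.eventually_lt_const (he'.trans_le (min_le_left _ _))
  obtain ⟨t₀, ht₀⟩ := hstart.exists
  have hshift : ∀ t ≥ t₀, ‖f t - e‖ < ‖e‖ := fun t ht => by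
    have := hst (fun s => f (s + t₀)) (fun s => (hf (s + t₀)).comp_add_const s t₀)
      (by simpa using ht₀) (t - t₀) (sub_nonneg.2 ht)
    simpa using this
  have hle : ‖-e' - e‖ ≤ ‖e‖ := le_of_tendsto (htop.sub_const e).norm
    ((Filter.eventually_ge_atTop t₀).mono fun t ht => (hshift t ht).le)
  have h2 : ‖(2 : ℝ) • e‖ ≤ ‖-e' - e‖ + ‖e' - e‖ := by
    rw [← norm_neg ((2 : ℝ) • e)]
    convert norm_add_le (-e' - e) (e' - e) using 2
    module
  rw [norm_smul, Real.norm_ofNat] at h2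
  linarith [he'.trans_le (min_le_right _ _)]

/-- the equilibria `(0,u,0,0,v,0)` with `u² ≠ v²` are not Lyapunov stable. -/
theorem t2_equilibria_unstable
    (l1 l2 l3 l4 : ℝ) (h12 : l2 < l1) (h23 : l3 < l2) (h34 : l4 < l3)
    (s12 : 0 < l1 + l2) (s13 : 0 < l1 + l3) (s14 : 0 < l1 + l4)
    (s23 : 0 < l2 + l3) (s24 : 0 < l2 + l4) (s34 : 0 < l3 + l4)
    (u v : ℝ) (huv : u ^ 2 ≠ v ^ 2) :
    vf l1 l2 l3 l4 ![0, u, 0, 0, v, 0] = 0 ∧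
      ¬ IsLyapunovStable l1 l2 l3 l4 ![0, u, 0, 0, v, 0] := by
  refine ⟨by ext i; fin_cases i <;> simp [vf], ?_⟩
  apply not_isLyapunovStable_of_heteroclinic
  · intro h0
    have hu : u = 0 := by simpa using congrFun h0 1
    have hv : v = 0 := by simpa using congrFun h0 4
    exact huv (by rw [hu, hv])
  intro δ hδ
  suffices ∃ w, |w - v| < δ ∧ (l2 + l4) ^ 2 * u ^ 2 ≠ (l1 + l3) ^ 2 * w ^ 2 by
    obtain ⟨w, hw, hne⟩ := this
    refine ⟨![0, u, 0, 0, w, 0], ?_, exists_heteroclinic_solution l1 l2 l3 l4 h12 h23 h34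
      s12 s13 s14 s23 s24 s34 u w hne⟩
    refine (pi_norm_lt_iff hδ).2 fun i => ?_
    fin_cases i <;> simp [hδ, hw]
  by_cases hd : (l2 + l4) ^ 2 * u ^ 2 = (l1 + l3) ^ 2 * v ^ 2
  · have hv : v ≠ 0 := by
      rintro rfl
      have : u = 0 := by simpa [s24.ne'] using hd
      exact huv (by rw [this])
    have hv' : 0 < |v| := abs_pos.2 hv
    refine ⟨v * (1 + δ / (2 * |v|)), ?_, ?_⟩
    · rw [show v * (1 + δ / (2 * |v|)) - v = v * (δ / (2 * |v|)) by ring, abs_mul,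
        abs_of_pos (show 0 < δ / (2 * |v|) by positivity),
        show |v| * (δ / (2 * |v|)) = δ / 2 by field_simp]
      linarith
    · rw [hd]
      have hη : 0 < δ / (2 * |v|) := by positivity
      generalize δ / (2 * |v|) = η at hη
      have : 0 < (l1 + l3) ^ 2 * v ^ 2 * (2 * η + η ^ 2) := by positivity
      apply ne_of_lt
      linarith
  · exact ⟨v, by simpa using hδ, hd⟩
end
end

section
/- Assume λ1² + λ4² < λ2² + λ3², and let a, b ∈ ℝ with a > 0 and α2·a² < b² < a² (where α2 is the larger real root of f̃). Then S1·a² − T1·b² > 0, and the number p1 = −(S1'·a² + T1'·b²)/(S1·a² − T1·b²) satisfies p1 < −T3/(2·S3). -/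
/-- An affine function that is positive at both endpoints is positive in between. -/
lemma affine_pos_of_endpoints {c d v x w : ℝ} (hv : 0 < c + d * v) (hw : 0 < c + d * w)
    (hvx : v ≤ x) (hxw : x ≤ w) : 0 < c + d * x := by
  rcases le_total 0 d with hd | hd
  · linarith [mul_le_mul_of_nonneg_left hvx hd]
  · linarith [mul_le_mul_of_nonpos_left hxw hd]

/-- To the right of its larger root, a convex quadratic is positive and lies to the right of
its vertex. -/
lemma quadratic_pos_right_of_roots {S N U α1 α2 x : ℝ} (hS : 0 < S) (hα : α1 < α2)
    (h1 : S * α1 ^ 2 - 2 * N * α1 + U = 0) (h2 : S * α2 ^ 2 - 2 * N * α2 + U = 0)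
    (hx : α2 < x) : N < S * x ∧ 0 < S * x ^ 2 - 2 * N * x + U := by
  have hsum : S * (α1 + α2) = 2 * N := by
    apply mul_left_cancel₀ (sub_ne_zero.2 hα.ne')
    linear_combination h2 - h1
  have hfac : S * x ^ 2 - 2 * N * x + U = S * ((x - α1) * (x - α2)) := by
    linear_combination h2 + (x - α2) * hsum
  refine ⟨by nlinarith, ?_⟩
  rw [hfac]
  exact mul_pos hS (mul_pos (by linarith) (by linarith))

/-- The key inequality between the extreme coefficients of the quadratic comparing the root of
`D1'` with the vertex of `g`. -/
lemma leading_coeff_lt_const_coeff_add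
    {l1 l2 l3 l4 : ℝ} (h12 : l2 < l1) (h23 : l3 < l2) (h34 : l4 < l3)
    (s12 : 0 < l1 + l2) (s13 : 0 < l1 + l3)
    (s23 : 0 < l2 + l3) (s24 : 0 < l2 + l4) (s34 : 0 < l3 + l4)
    (hlt : l1 ^ 2 + l4 ^ 2 < l2 ^ 2 + l3 ^ 2) :
    (l1 + l4) * (l1 ^ 2 - l2 ^ 2) * (l1 + l2) * (l1 + l3) <
      (l2 + l3) * (l1 + l3) * (l3 + l4) * (l3 ^ 2 - l4 ^ 2) +
        (l1 + l2 + l3 + l4) * (2 * (l1 ^ 2 - l2 ^ 2) * (l3 ^ 2 - l4 ^ 2) +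
          (l1 ^ 2 - l2 ^ 2) * (l2 ^ 2 - l3 ^ 2) + (l2 ^ 2 - l3 ^ 2) * (l3 ^ 2 - l4 ^ 2)) := by
  have hgap : 0 < l2 + l3 - l1 - l4 := by
    nlinarith [mul_pos (sub_pos.2 h12) (by linarith : 0 < (l1 + l2) - (l3 + l4))]
  have hP : 0 < l1 ^ 2 - l2 ^ 2 := by
    rw [sq_sub_sq]; exact mul_pos s12 (sub_pos.2 h12)
  have hQ : 0 < l2 ^ 2 - l3 ^ 2 := by
    rw [sq_sub_sq]; exact mul_pos s23 (sub_pos.2 h23)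
  have hRP : 0 < (l3 ^ 2 - l4 ^ 2) - (l1 ^ 2 - l2 ^ 2) := by linarith
  have hR : 0 < l3 ^ 2 - l4 ^ 2 := by linarith
  have e1 := mul_pos (mul_pos (mul_pos s23 s13) s34) hRP
  have e2 := mul_pos (mul_pos s13 hP) hRP
  have e3 := mul_pos (mul_pos s13 hQ) hRP
  have e4 := mul_pos (mul_pos s13 hP) (mul_pos s24 hgap)
  have e5 := mul_pos s24 (mul_pos hP hR)
  have e6 := mul_pos s24 (mul_pos hP hQ)
  have e7 := mul_pos s24 (mul_pos hQ hR)
  linarith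


/-- if `λ1² + λ4² < λ2² + λ3²` and `α2·a² < b² < a²`, then
`S1·a² − T1·b² > 0` and the root `p1` of `D1'` lies strictly to the left of the
minimum point `−T3/(2S3)` of the parabola `g`. -/
theorem p1_left_of_vertex
    (l1 l2 l3 l4 : ℝ) (h12 : l2 < l1) (h23 : l3 < l2) (h34 : l4 < l3)
    (s12 : 0 < l1 + l2) (s13 : 0 < l1 + l3) (s14 : 0 < l1 + l4)
    (s23 : 0 < l2 + l3) (s24 : 0 < l2 + l4) (s34 : 0 < l3 + l4)
    (hlt : l1 ^ 2 + l4 ^ 2 < l2 ^ 2 + l3 ^ 2)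
    (α1 α2 : ℝ) (hα : α1 < α2)
    (hr1 : (l1^2 - l4^2)^2 * α1 ^ 2
        - 2 * ((l1^2 - l2^2) * (l3^2 - l4^2) + (l1^2 - l3^2) * (l2^2 - l4^2)) * α1
        + (l2^2 - l3^2)^2 = 0)
    (hr2 : (l1^2 - l4^2)^2 * α2 ^ 2
        - 2 * ((l1^2 - l2^2) * (l3^2 - l4^2) + (l1^2 - l3^2) * (l2^2 - l4^2)) * α2
        + (l2^2 - l3^2)^2 = 0)
    (a b : ℝ) (hapos : 0 < a) (hlo : α2 * a ^ 2 < b ^ 2) (hhi : b ^ 2 < a ^ 2)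
    (S1 T1 S1' T1' S3 T3 p1 : ℝ)
    (hS1 : S1 = (l2 + l3) * (l3^2 - l4^2))
    (hT1 : T1 = (l2 + l3) * (l1^2 - l2^2))
    (hS1' : S1' = -((l2 + l3) * (l3^2 - l4^2)))
    (hT1' : T1' = (l1 - l2) * (l1 + l4) * (l3 + l4))
    (hS3 : S3 = (l1 + l2) * (l2 + l4) * (l2 + l3)^2 * (a^2 - b^2))
    (hT3 : T3 = -(2 * (l2 + l3) *
      ((l2 + l3) * ((l1 + l2) * (l2 + l4) + (l1 + l3) * (l3 + l4)) * a^2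
        - (l1 + l4) * ((l1 + l2) * (l1 + l3) + (l2 + l4) * (l3 + l4)) * b^2)))
    (hp1 : p1 = -(S1' * a^2 + T1' * b^2) / (S1 * a^2 - T1 * b^2)) :
    0 < S1 * a ^ 2 - T1 * b ^ 2 ∧ p1 < -T3 / (2 * S3) := by
  have hA : 0 < a ^ 2 := by positivity
  obtain ⟨x, hx⟩ : ∃ x, b ^ 2 = x * a ^ 2 := ⟨b ^ 2 / a ^ 2, by field_simp⟩
  rw [hx] at hlo hhi
  have hαx : α2 < x := lt_of_mul_lt_mul_right hlo hA.le
  have hx1 : x < 1 := lt_of_mul_lt_mul_right (by linarith) hA.le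
  have hP : 0 < l1 ^ 2 - l2 ^ 2 := by
    rw [sq_sub_sq]; exact mul_pos s12 (sub_pos.2 h12)
  have hQ : 0 < l2 ^ 2 - l3 ^ 2 := by
    rw [sq_sub_sq]; exact mul_pos s23 (sub_pos.2 h23)
  have hRP : 0 < (l3 ^ 2 - l4 ^ 2) - (l1 ^ 2 - l2 ^ 2) := by linarith
  have hK := leading_coeff_lt_const_coeff_add h12 h23 h34 s12 s13 s23 s24 s34 hlt
  have hS : 0 < (l1 ^ 2 - l4 ^ 2) ^ 2 := by
    have : 0 < l1 ^ 2 - l4 ^ 2 := by linarith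
    positivity
  obtain ⟨hNx, hf⟩ := quadratic_pos_right_of_roots hS hα hr1 hr2 hαx
  have hσ : 0 < l1 + l2 + l3 + l4 := by linarith
  set H0 := (l2 + l3) * (l1 + l3) * (l3 + l4) * (l3 ^ 2 - l4 ^ 2) with hH0
  set H2 := (l1 + l4) * (l1 ^ 2 - l2 ^ 2) * (l1 + l2) * (l1 + l3) with hH2
  have hH2pos : 0 < H2 := by positivity
  set P := l1 ^ 2 - l2 ^ 2 with hPdef
  set Q := l2 ^ 2 - l3 ^ 2 with hQdef
  set R := l3 ^ 2 - l4 ^ 2 with hRdef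
  set σ := l1 + l2 + l3 + l4 with hσdef
  have hR : 0 < R := by linarith
  have eS : l1 ^ 2 - l4 ^ 2 = P + Q + R := by rw [hPdef, hQdef, hRdef]; ring
  have e13 : l1 ^ 2 - l3 ^ 2 = P + Q := by rw [hPdef, hQdef]; ring
  have e24 : l2 ^ 2 - l4 ^ 2 = Q + R := by rw [hQdef, hRdef]; ring
  rw [eS, e13, e24] at hNx hf
  rw [eS] at hS
  have hNS : P * R + (P + Q) * (Q + R) < (P + Q + R) ^ 2 := by
    have : 0 < P ^ 2 + R ^ 2 + P * Q + Q * R := by positivity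
    linarith
  have hlin : 0 < (H0 - σ * Q ^ 2) + (σ * (P + Q + R) ^ 2 - H2) * x := by
    refine affine_pos_of_endpoints
      (v := (P * R + (P + Q) * (Q + R)) / (P + Q + R) ^ 2) (w := 1) ?_ ?_ ?_ hx1.le
    · have e : (H0 - σ * Q ^ 2) + (σ * (P + Q + R) ^ 2 - H2) *
          ((P * R + (P + Q) * (Q + R)) / (P + Q + R) ^ 2) =
          ((P + Q + R) ^ 2 * (H0 + σ * (2 * P * R + P * Q + Q * R) - H2) +
            H2 * ((P + Q + R) ^ 2 - (P * R + (P + Q) * (Q + R)))) / (P + Q + R) ^ 2 := by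
        field_simp
        ring
      rw [e]
      exact div_pos (add_pos (mul_pos hS (by linarith)) (mul_pos hH2pos (by linarith))) hS
    · have : 0 < σ * (P ^ 2 + R ^ 2 + P * Q + Q * R) := by positivity
      linarith
    · rw [div_le_iff₀ hS]
      linarith
  have hH : 0 < σ * ((P + Q + R) ^ 2 * x ^ 2 - 2 * (P * R + (P + Q) * (Q + R)) * x + Q ^ 2) +
      (1 - x) * ((H0 - σ * Q ^ 2) + (σ * (P + Q + R) ^ 2 - H2) * x) :=
    add_pos (mul_pos hσ hf) (mul_pos (by linarith) hlin)
  have hden : 0 < S1 * a ^ 2 - T1 * b ^ 2 := by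
    have e : S1 * a ^ 2 - T1 * b ^ 2 = (l2 + l3) * a ^ 2 * ((R - P) + P * (1 - x)) := by
      rw [hS1, hT1, hx]; ring
    rw [e]
    exact mul_pos (mul_pos s23 hA) (add_pos hRP (mul_pos hP (by linarith)))
  have hS3pos : 0 < S3 := by
    rw [hS3, hx]
    exact mul_pos (by positivity) (by linarith)
  refine ⟨hden, ?_⟩
  rw [hp1, div_lt_div_iff₀ hden (by linarith), ← sub_pos]
  have e : -T3 * (S1 * a ^ 2 - T1 * b ^ 2) - -(S1' * a ^ 2 + T1' * b ^ 2) * (2 * S3) =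
      2 * (l2 + l3) ^ 2 * (a ^ 2) ^ 2 *
      (σ * ((P + Q + R) ^ 2 * x ^ 2 - 2 * (P * R + (P + Q) * (Q + R)) * x + Q ^ 2) +
      (1 - x) * ((H0 - σ * Q ^ 2) + (σ * (P + Q + R) ^ 2 - H2) * x)) := by
    rw [hT3, hS1, hT1, hS1', hT1', hS3, hx, hH0, hH2, hσdef, hPdef, hQdef, hRdef]
    ring
  rw [e]
  exact mul_pos (by positivity) hH
end

section
/- Assume λ1² + λ4² ≠ λ2² + λ3², and let a, b ∈ ℝ with a > 0 and α2·a² < b² < a² (where α2 is the larger real root of f̃). Then there exist p, m, n ∈ ℝ such that the function F = H + (p/(2(λ1+λ3)(λ1+λ4)(λ3+λ4)))·I + m·C1 + n·C2 : ℝ^6 → ℝ has vanishing derivative at the equilibrium e = (b, 0, 0, a, 0, 0), and the Hessian quadratic form of F at e is positive definite on the subspace W = {v ∈ ℝ^6 : dC1(e)(v) = 0 and dC2(e)(v) = 0}, i.e., d²F(e)(v,v) > 0 for every nonzero v ∈ W. -/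
noncomputable section

/-- Casimir `C1`. -/
def C1fun (p : Fin 6 → ℝ) : ℝ :=
  (p 0 ^ 2 + p 1 ^ 2 + p 2 ^ 2 + p 3 ^ 2 + p 4 ^ 2 + p 5 ^ 2) / 2

/-- Casimir `C2`. -/
def C2fun (p : Fin 6 → ℝ) : ℝ := p 0 * p 3 + p 1 * p 4 + p 2 * p 5

/-- The Hamiltonian `H`. -/
def Hfun (l1 l2 l3 l4 : ℝ) (p : Fin 6 → ℝ) : ℝ :=
  (1/2) * (p 0 ^ 2 / (l2 + l3) + p 1 ^ 2 / (l1 + l3) + p 2 ^ 2 / (l1 + l2)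
    + p 3 ^ 2 / (l1 + l4) + p 4 ^ 2 / (l2 + l4) + p 5 ^ 2 / (l3 + l4))

/-- Mishchenko's integral `I`. -/
def Ifun (l1 l2 l3 l4 : ℝ) (p : Fin 6 → ℝ) : ℝ :=
  (l2^2 + l3^2) * p 0 ^ 2 + (l1^2 + l3^2) * p 1 ^ 2 + (l1^2 + l2^2) * p 2 ^ 2
    + (l1^2 + l4^2) * p 3 ^ 2 + (l2^2 + l4^2) * p 4 ^ 2 + (l3^2 + l4^2) * p 5 ^ 2

/-- The symmetric bilinear form on `ℝ^6` with diagonal entries `d` and entries `n` coupling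
the coordinates `i` and `i + 3`. -/
def coupledForm (d : Fin 6 → ℝ) (n : ℝ) : (Fin 6 → ℝ) →L[ℝ] (Fin 6 → ℝ) →L[ℝ] ℝ :=
  ∑ i : Fin 6, (d i • ContinuousLinearMap.proj (R := ℝ) (φ := fun _ : Fin 6 => ℝ) i
    + n • ContinuousLinearMap.proj (R := ℝ) (φ := fun _ : Fin 6 => ℝ) (i + 3)).smulRight
      (ContinuousLinearMap.proj (R := ℝ) (φ := fun _ : Fin 6 => ℝ) i)

lemma coupledForm_apply (d : Fin 6 → ℝ) (n : ℝ) (v w : Fin 6 → ℝ) :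
    coupledForm d n v w = (d 0 * v 0 + n * v 3) * w 0 + (d 1 * v 1 + n * v 4) * w 1
      + (d 2 * v 2 + n * v 5) * w 2 + (d 3 * v 3 + n * v 0) * w 3
      + (d 4 * v 4 + n * v 1) * w 4 + (d 5 * v 5 + n * v 2) * w 5 := by
  simp only [coupledForm, Fin.sum_univ_six, add_apply, smul_apply, smul_eq_mul,
    ContinuousLinearMap.smulRight_apply, ContinuousLinearMap.proj_apply, zero_add,
    show (1 + 3 : Fin 6) = 4 from rfl, show (2 + 3 : Fin 6) = 5 from rfl,
    show (3 + 3 : Fin 6) = 0 from rfl, show (4 + 3 : Fin 6) = 1 from rfl,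
    show (5 + 3 : Fin 6) = 2 from rfl]

/-- The derivative of the quadratic form of a symmetric bounded bilinear form. -/
lemma fderiv_half_bilin {E : Type*} [NormedAddCommGroup E] [NormedSpace ℝ E]
    (G : E →L[ℝ] E →L[ℝ] ℝ) (hG : ∀ v w, G v w = G w v) :
    fderiv ℝ (fun q => 1 / 2 * G q q) = fun q => G q := by
  funext q
  refine HasFDerivAt.fderiv ?_
  refine ((G.hasFDerivAt.clm_apply (hasFDerivAt_id q)).const_mul (1 / 2)).congr_fderiv ?_
  ext w
  simp [hG w q]
  ring

lemma fderiv_of_eq_coupledForm {f : (Fin 6 → ℝ) → ℝ} (d : Fin 6 → ℝ) (n : ℝ)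
    (hf : ∀ q, f q = 1 / 2 * coupledForm d n q q) :
    fderiv ℝ f = fun q => coupledForm d n q := by
  rw [funext hf]
  refine fderiv_half_bilin _ fun v w => ?_
  rw [coupledForm_apply, coupledForm_apply]
  ring

lemma fderiv_C1fun (q v : Fin 6 → ℝ) :
    fderiv ℝ C1fun q v = q 0 * v 0 + q 1 * v 1 + q 2 * v 2 + q 3 * v 3 + q 4 * v 4
      + q 5 * v 5 := by
  rw [fderiv_of_eq_coupledForm (fun _ => 1) 0 fun q => by
    rw [coupledForm_apply, C1fun]; ring]
  rw [coupledForm_apply]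
  ring

lemma fderiv_C2fun (q v : Fin 6 → ℝ) :
    fderiv ℝ C2fun q v = q 3 * v 0 + q 4 * v 1 + q 5 * v 2 + q 0 * v 3 + q 1 * v 4
      + q 2 * v 5 := by
  rw [fderiv_of_eq_coupledForm (fun _ => 0) 1 fun q => by
    rw [coupledForm_apply, C2fun]; ring]
  rw [coupledForm_apply]
  ring

/-- A binary quadratic form with positive diagonal and positive determinant is positive
definite. -/
lemma binary_form_pos {d e n x y : ℝ} (hd : 0 < d) (hdet : n ^ 2 < d * e)
    (hxy : x ≠ 0 ∨ y ≠ 0) : 0 < (d * x + n * y) * x + (e * y + n * x) * y := by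
  have key : d * ((d * x + n * y) * x + (e * y + n * x) * y)
      = (d * x + n * y) ^ 2 + (d * e - n ^ 2) * y ^ 2 := by ring
  refine pos_of_mul_pos_right ?_ hd.le
  rw [key]
  by_cases hy : y = 0
  · subst hy
    have hx : x ≠ 0 := by simpa using hxy
    have : d * x ≠ 0 := mul_ne_zero hd.ne' hx
    simp only [mul_zero, add_zero]
    positivity
  · have : 0 < d * e - n ^ 2 := sub_pos.2 hdet
    positivity

lemma binary_form_nonneg {d e n : ℝ} (hd : 0 < d) (hdet : n ^ 2 < d * e) (x y : ℝ) :
    0 ≤ (d * x + n * y) * x + (e * y + n * x) * y := by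
  by_cases h : x ≠ 0 ∨ y ≠ 0
  · exact (binary_form_pos hd hdet h).le
  · push Not at h
    simp [h.1, h.2]

/-- Beyond the larger root of a monic-up-to-scale quadratic with a positive leading and a
positive constant coefficient, the quadratic is positive and its argument exceeds the geometric
mean of the roots. -/
lemma quadratic_beyond_larger_root {N y T α β t : ℝ} (hN : 0 < N) (hy : 0 < y) (hT : 0 ≤ T)
    (hαβ : α < β) (hα : N ^ 2 * α ^ 2 - 2 * T * α + y ^ 2 = 0)
    (hβ : N ^ 2 * β ^ 2 - 2 * T * β + y ^ 2 = 0) (ht : β < t) :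
    0 < N ^ 2 * t ^ 2 - 2 * T * t + y ^ 2 ∧ y < t * N := by
  have hsum : 2 * T = N ^ 2 * (α + β) := by
    apply mul_left_cancel₀ (sub_pos.2 hαβ).ne'
    linear_combination hα - hβ
  have hprod : y ^ 2 = N ^ 2 * (α * β) := by
    linear_combination hα + α * hsum
  have hα0 : 0 < α := by
    by_contra! h
    have : 0 ≤ T * (-α) := mul_nonneg hT (by linarith)
    have : 0 < y ^ 2 := by positivity
    nlinarith [mul_nonneg (sq_nonneg N) (sq_nonneg α)]
  have hβ0 : 0 < β := hα0.trans hαβ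
  have ht0 : 0 < t := hβ0.trans ht
  constructor
  · have : 0 < N ^ 2 * ((t - α) * (t - β)) :=
      mul_pos (by positivity) (mul_pos (by linarith) (by linarith))
    linear_combination this + t * hsum - hprod
  · refine lt_of_pow_lt_pow_left₀ 2 (by positivity) ?_
    have : α * β < t * t := mul_lt_mul'' (hαβ.trans ht) ht hα0.le hβ0.le
    nlinarith [mul_lt_mul_of_pos_left this (pow_pos hN 2)]

/-- Positivity of the third divided difference of a function with first divided differences
`v / x`, `1`, `v / z` on nodes with gaps `x`, `y`, `z`, where `2 v = σ`. -/
lemma third_divided_difference_pos {x y z σ : ℝ} (hx : 0 < x) (hy : 0 < y) (hz : 0 < z)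
    (hσ : 0 < σ) (hq : 4 * (x * z) * (σ + y) < (x + y + z) * σ ^ 2) :
    2 * (x * z) * (x + 2 * y + z) < σ * (z * (y + z) + x * (x + y)) := by
  set R := x + 2 * y + z with hR
  set K := z * (y + z) + x * (x + y) with hK
  have hRpos : 0 < R := by positivity
  have hKpos : 0 < K := by positivity
  have hxz : 0 < x * z := by positivity
  have hKR : x * z * R ^ 2 ≤ K ^ 2 := by
    have h1 : (x + z) * R / 2 ≤ K := by
      rw [hR, hK]; nlinarith [sq_nonneg (x - z)]
    have h2 : ((x + z) * R / 2) ^ 2 ≤ K ^ 2 := pow_le_pow_left₀ (by positivity) h1 2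
    nlinarith [mul_nonneg (sq_nonneg (x - z)) (sq_nonneg R)]
  have hroot : x * z * (x + y + z) * R ^ 2 ≤ 2 * (x * z) * R * K + y * K ^ 2 := by
    have e : (x + y + z) * R - 2 * K = y * R - (x - z) ^ 2 := by rw [hR, hK]; ring
    have h3 : 0 ≤ x * z * R * (x - z) ^ 2 := by positivity
    nlinarith [mul_le_mul_of_nonneg_left hKR hy.le, congrArg (fun r => x * z * R * r) e]
  by_contra! h
  -- `K σ ≤ 2 x z R` contradicts the sign of the quadratic at `2 x z R / K`.
  have h4 : (x + y + z) * (K * σ) ≤ (x + y + z) * (2 * (x * z) * R) :=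
    mul_le_mul_of_nonneg_left (by linarith) (by positivity)
  have h5 : (4 * (x * z) * (σ + y)) * K < ((x + y + z) * σ ^ 2) * K :=
    mul_lt_mul_of_pos_right hq hKpos
  have h6 : (x + y + z) * σ ^ 2 * K ≤ (x + y + z) * (2 * (x * z) * R) * σ := by
    nlinarith [mul_le_mul_of_nonneg_right h4 hσ.le]
  have h7 : 2 * ((σ + y) * K) < (x + y + z) * R * σ := by
    have : (x * z) * (2 * ((σ + y) * K)) < (x * z) * ((x + y + z) * R * σ) := by linarith
    exact lt_of_mul_lt_mul_left this hxz.le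
  have h8 : 2 * y * K < ((x + y + z) * R - 2 * K) * σ := by linarith
  have h9 : 0 < (x + y + z) * R - 2 * K := by
    by_contra! h'
    have : ((x + y + z) * R - 2 * K) * σ ≤ 0 := mul_nonpos_of_nonpos_of_nonneg h' hσ.le
    have : 0 < 2 * y * K := by positivity
    linarith
  have h10 : 2 * y * K * K < ((x + y + z) * R - 2 * K) * (σ * K) := by
    nlinarith [mul_lt_mul_of_pos_right h8 hKpos]
  have h11 := mul_le_mul_of_nonneg_left h h9.le
  nlinarith

/-- Coefficients making the divided differences of `λ + 2 k λ^4 + m λ^2` over the nodes `λ_i^2`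
proportional to the prescribed ones. -/
lemma exists_divided_differences {l1 l2 l3 l4 v : ℝ} (h12 : l2 < l1) (h23 : l3 < l2)
    (h34 : l4 < l3) (s12 : 0 < l1 + l2) (s13 : 0 < l1 + l3)
    (s23 : 0 < l2 + l3) (s24 : 0 < l2 + l4) (s34 : 0 < l3 + l4)
    (hv : 0 < (v / (l1 ^ 2 - l2 ^ 2) - 1) / (l1 ^ 2 - l3 ^ 2)
      - (1 - v / (l3 ^ 2 - l4 ^ 2)) / (l2 ^ 2 - l4 ^ 2)) :
    ∃ s k m : ℝ, 0 < s ∧ 1 / (l2 + l3) + 2 * k * (l2 ^ 2 + l3 ^ 2) + m = s ∧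
      1 / (l1 + l2) + 2 * k * (l1 ^ 2 + l2 ^ 2) + m = s * (v / (l1 ^ 2 - l2 ^ 2)) ∧
      1 / (l3 + l4) + 2 * k * (l3 ^ 2 + l4 ^ 2) + m = s * (v / (l3 ^ 2 - l4 ^ 2)) := by
  have hAC : 0 < l1 ^ 2 - l3 ^ 2 := by nlinarith
  have hBD : 0 < l2 ^ 2 - l4 ^ 2 := by nlinarith
  set P := v / (l1 ^ 2 - l2 ^ 2)
  set Q := v / (l3 ^ 2 - l4 ^ 2)
  set G := (P - 1) / (l1 ^ 2 - l3 ^ 2) - (1 - Q) / (l2 ^ 2 - l4 ^ 2) with hG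
  set Λ := (1 / (l1 + l2) - 1 / (l2 + l3)) / (l1 ^ 2 - l3 ^ 2)
    - (1 / (l2 + l3) - 1 / (l3 + l4)) / (l2 ^ 2 - l4 ^ 2) with hΛdef
  have hΛ : 0 < Λ := by
    have h1 : (1 / (l1 + l2) - 1 / (l2 + l3)) / (l1 ^ 2 - l3 ^ 2)
        = -(1 / ((l1 + l2) * (l2 + l3) * (l1 + l3))) := by
      field_simp; ring
    have h2 : (1 / (l2 + l3) - 1 / (l3 + l4)) / (l2 ^ 2 - l4 ^ 2)
        = -(1 / ((l2 + l3) * (l3 + l4) * (l2 + l4))) := by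
      field_simp; ring
    rw [hΛdef, h1, h2, sub_neg_eq_add, neg_add_eq_sub, sub_pos]
    apply one_div_lt_one_div_of_lt (by positivity)
    have : (l2 + l4) * (l3 + l4) < (l1 + l2) * (l1 + l3) :=
      mul_lt_mul'' (by linarith) (by linarith) s24.le s34.le
    nlinarith [mul_lt_mul_of_pos_left this s23]
  have hs : Λ / G * G = Λ := div_mul_cancel₀ _ hv.ne'
  set s := Λ / G with hsdef
  set κ := (s * (P - 1) - (1 / (l1 + l2) - 1 / (l2 + l3))) / (l1 ^ 2 - l3 ^ 2) with hκ
  have hκ1 : κ * (l1 ^ 2 - l3 ^ 2) = s * (P - 1) - (1 / (l1 + l2) - 1 / (l2 + l3)) :=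
    div_mul_cancel₀ _ hAC.ne'
  have hκ2 : κ * (l2 ^ 2 - l4 ^ 2) = s * (1 - Q) - (1 / (l2 + l3) - 1 / (l3 + l4)) := by
    have : κ = (s * (1 - Q) - (1 / (l2 + l3) - 1 / (l3 + l4))) / (l2 ^ 2 - l4 ^ 2) := by
      rw [hG, hΛdef] at hs
      rw [hκ]
      linear_combination hs
    rw [this, div_mul_cancel₀ _ hBD.ne']
  refine ⟨s, κ / 2, s - 1 / (l2 + l3) - κ * (l2 ^ 2 + l3 ^ 2), div_pos hΛ hv, by ring, ?_, ?_⟩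
  · linear_combination hκ1
  · linear_combination -hκ2

/-- Coefficients `k`, `m` for which the diagonal Hessian entries satisfy the critical point relations
and the two transverse `2 × 2` blocks have positive determinant. -/
lemma exists_lyapunov_coefficients {l1 l2 l3 l4 t : ℝ} (h12 : l2 < l1) (h23 : l3 < l2)
    (h34 : l4 < l3) (s12 : 0 < l1 + l2) (s13 : 0 < l1 + l3) (s14 : 0 < l1 + l4)
    (s23 : 0 < l2 + l3) (s24 : 0 < l2 + l4) (s34 : 0 < l3 + l4)
    (hf : 0 < (l1 ^ 2 - l4 ^ 2) ^ 2 * t ^ 2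
      - 2 * ((l1 ^ 2 - l2 ^ 2) * (l3 ^ 2 - l4 ^ 2) + (l1 ^ 2 - l3 ^ 2) * (l2 ^ 2 - l4 ^ 2)) * t
      + (l2 ^ 2 - l3 ^ 2) ^ 2)
    (ht : l2 ^ 2 - l3 ^ 2 < t * (l1 ^ 2 - l4 ^ 2)) :
    ∃ s k m : ℝ, 1 / (l2 + l3) + 2 * k * (l2 ^ 2 + l3 ^ 2) + m = s ∧
      1 / (l1 + l4) + 2 * k * (l1 ^ 2 + l4 ^ 2) + m = s * t ∧
      0 < 1 / (l1 + l3) + 2 * k * (l1 ^ 2 + l3 ^ 2) + m ∧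
      0 < 1 / (l1 + l2) + 2 * k * (l1 ^ 2 + l2 ^ 2) + m ∧
      s ^ 2 * t < (1 / (l1 + l3) + 2 * k * (l1 ^ 2 + l3 ^ 2) + m)
        * (1 / (l2 + l4) + 2 * k * (l2 ^ 2 + l4 ^ 2) + m) ∧
      s ^ 2 * t < (1 / (l1 + l2) + 2 * k * (l1 ^ 2 + l2 ^ 2) + m)
        * (1 / (l3 + l4) + 2 * k * (l3 ^ 2 + l4 ^ 2) + m) := by
  obtain ⟨x, hx⟩ : ∃ x, x = l1 ^ 2 - l2 ^ 2 := ⟨_, rfl⟩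
  obtain ⟨y, hy⟩ : ∃ y, y = l2 ^ 2 - l3 ^ 2 := ⟨_, rfl⟩
  obtain ⟨z, hz⟩ : ∃ z, z = l3 ^ 2 - l4 ^ 2 := ⟨_, rfl⟩
  have hx0 : 0 < x := by nlinarith
  have hy0 : 0 < y := by nlinarith
  have hz0 : 0 < z := by nlinarith
  have hxy : l1 ^ 2 - l3 ^ 2 = x + y := by rw [hx, hy]; ring
  have hyz : l2 ^ 2 - l4 ^ 2 = y + z := by rw [hy, hz]; ring
  have hN : l1 ^ 2 - l4 ^ 2 = x + y + z := by rw [hx, hy, hz]; ring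
  rw [hN, ← hx, ← hy, ← hz, hxy, hyz] at hf
  rw [hN, ← hy] at ht
  obtain ⟨v, hvdef⟩ : ∃ v, v = (t * (x + y + z) - y) / 2 := ⟨_, rfl⟩
  have hv0 : 0 < v := by linarith
  have hvt : t * (x + y + z) = 2 * v + y := by linarith
  have hv2 : t * (x * z) < v ^ 2 := by rw [hvdef]; linarith
  have hv3 : t * ((x + y) * (y + z)) < (v + y) ^ 2 := by
    linear_combination hv2 + y * hvt
  have hdd := third_divided_difference_pos (σ := 2 * v) hx0 hy0 hz0 (by positivity) (by
    have := mul_lt_mul_of_pos_left hv2 (show 0 < 4 * (x + y + z) by positivity)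
    linear_combination this - 4 * (x * z) * hvt)
  obtain ⟨s, k, m, hs, e0, e2, e5⟩ := exists_divided_differences (v := v) h12 h23 h34 s12 s13
    s23 s24 s34 (by
      rw [hxy, hyz, ← hx, ← hz]
      have : (v / x - 1) / (x + y) - (1 - v / z) / (y + z)
          = (2 * v * (z * (y + z) + x * (x + y)) - 2 * (x * z) * (x + 2 * y + z))
            / (2 * (x * z) * ((x + y) * (y + z))) := by
        field_simp; ring
      rw [this]
      exact div_pos (sub_pos.2 hdd) (by positivity))
  rw [← hx] at e2
  rw [← hz] at e5
  have g0 : (1 / (l2 + l3)) * y = l2 - l3 := by rw [hy]; field_simp; ring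
  have g1 : (1 / (l1 + l3)) * (x + y) = l1 - l3 := by rw [← hxy]; field_simp; ring
  have g2 : (1 / (l1 + l2)) * x = l1 - l2 := by rw [hx]; field_simp; ring
  have g3 : (1 / (l1 + l4)) * (x + y + z) = l1 - l4 := by rw [← hN]; field_simp; ring
  have g4 : (1 / (l2 + l4)) * (y + z) = l2 - l4 := by rw [← hyz]; field_simp; ring
  have g5 : (1 / (l3 + l4)) * z = l3 - l4 := by rw [hz]; field_simp; ring
  have e2' : (1 / (l1 + l2) + 2 * k * (l1 ^ 2 + l2 ^ 2) + m) * x = s * v := by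
    rw [e2]; field_simp
  have e5' : (1 / (l3 + l4) + 2 * k * (l3 ^ 2 + l4 ^ 2) + m) * z = s * v := by
    rw [e5]; field_simp
  have e1 : 1 / (l1 + l3) + 2 * k * (l1 ^ 2 + l3 ^ 2) + m = s * ((v + y) / (x + y)) := by
    rw [← mul_div_assoc, eq_div_iff (by positivity)]
    have : (2 * k * (l1 ^ 2 + l3 ^ 2)) * (x + y)
        = (2 * k * (l1 ^ 2 + l2 ^ 2)) * x + (2 * k * (l2 ^ 2 + l3 ^ 2)) * y := by
      rw [hx, hy]; ring
    linear_combination g1 + this + e2' + y * e0 - g2 - g0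
  have e4 : 1 / (l2 + l4) + 2 * k * (l2 ^ 2 + l4 ^ 2) + m = s * ((v + y) / (y + z)) := by
    rw [← mul_div_assoc, eq_div_iff (by positivity)]
    have : (2 * k * (l2 ^ 2 + l4 ^ 2)) * (y + z)
        = (2 * k * (l2 ^ 2 + l3 ^ 2)) * y + (2 * k * (l3 ^ 2 + l4 ^ 2)) * z := by
      rw [hy, hz]; ring
    linear_combination g4 + this + e5' + y * e0 - g5 - g0
  have e3 : 1 / (l1 + l4) + 2 * k * (l1 ^ 2 + l4 ^ 2) + m = s * t := by
    apply mul_right_cancel₀ (show x + y + z ≠ 0 by positivity)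
    have : (2 * k * (l1 ^ 2 + l4 ^ 2)) * (x + y + z)
        = (2 * k * (l1 ^ 2 + l2 ^ 2)) * x + (2 * k * (l2 ^ 2 + l3 ^ 2)) * y
          + (2 * k * (l3 ^ 2 + l4 ^ 2)) * z := by
      rw [hx, hy, hz]; ring
    linear_combination g3 + this + e2' + e5' + y * e0 - g2 - g0 - g5 - s * hvt
  refine ⟨s, k, m, e0, e3, ?_, ?_, ?_, ?_⟩
  · rw [e1]; positivity
  · rw [e2]; positivity
  · rw [e1, e4]
    have : s * ((v + y) / (x + y)) * (s * ((v + y) / (y + z)))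
        = s ^ 2 * ((v + y) ^ 2 / ((x + y) * (y + z))) := by field_simp
    rw [this]
    exact mul_lt_mul_of_pos_left ((lt_div_iff₀ (by positivity)).2 hv3) (by positivity)
  · rw [e2, e5]
    have : s * (v / x) * (s * (v / z)) = s ^ 2 * (v ^ 2 / (x * z)) := by field_simp
    rw [this]
    exact mul_lt_mul_of_pos_left ((lt_div_iff₀ (by positivity)).2 hv2) (by positivity)

/-- for `α2·a² < b² < a²` (with `λ1² + λ4² ≠ λ2² + λ3²`) there are
`p, m, n` such that `H + (p/(2(λ1+λ3)(λ1+λ4)(λ3+λ4)))·I + m·C1 + n·C2` has a critical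
point at the equilibrium `(b,0,0,a,0,0)` with Hessian positive definite on
`W = ker dC1(e) ∩ ker dC2(e)`. -/
theorem lyapunov_function_bifurcation_case
    (l1 l2 l3 l4 : ℝ) (h12 : l2 < l1) (h23 : l3 < l2) (h34 : l4 < l3)
    (s12 : 0 < l1 + l2) (s13 : 0 < l1 + l3) (s14 : 0 < l1 + l4)
    (s23 : 0 < l2 + l3) (s24 : 0 < l2 + l4) (s34 : 0 < l3 + l4)
    (hne : l1 ^ 2 + l4 ^ 2 ≠ l2 ^ 2 + l3 ^ 2)
    (α1 α2 : ℝ) (hα : α1 < α2)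
    (hr1 : (l1^2 - l4^2)^2 * α1 ^ 2
        - 2 * ((l1^2 - l2^2) * (l3^2 - l4^2) + (l1^2 - l3^2) * (l2^2 - l4^2)) * α1
        + (l2^2 - l3^2)^2 = 0)
    (hr2 : (l1^2 - l4^2)^2 * α2 ^ 2
        - 2 * ((l1^2 - l2^2) * (l3^2 - l4^2) + (l1^2 - l3^2) * (l2^2 - l4^2)) * α2
        + (l2^2 - l3^2)^2 = 0)
    (a b : ℝ) (hapos : 0 < a) (hlo : α2 * a ^ 2 < b ^ 2) (hhi : b ^ 2 < a ^ 2) :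
    ∃ p m n : ℝ,
      fderiv ℝ (fun q => Hfun l1 l2 l3 l4 q
          + (p / (2 * (l1 + l3) * (l1 + l4) * (l3 + l4))) * Ifun l1 l2 l3 l4 q
          + m * C1fun q + n * C2fun q) ![b, 0, 0, a, 0, 0] = 0 ∧
      ∀ v : Fin 6 → ℝ, v ≠ 0 →
        fderiv ℝ C1fun ![b, 0, 0, a, 0, 0] v = 0 →
        fderiv ℝ C2fun ![b, 0, 0, a, 0, 0] v = 0 →
        0 < fderiv ℝ (fderiv ℝ (fun q => Hfun l1 l2 l3 l4 q
              + (p / (2 * (l1 + l3) * (l1 + l4) * (l3 + l4))) * Ifun l1 l2 l3 l4 q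
              + m * C1fun q + n * C2fun q)) ![b, 0, 0, a, 0, 0] v v := by
  have hN : 0 < l1 ^ 2 - l4 ^ 2 := by nlinarith
  have hx : 0 < l1 ^ 2 - l2 ^ 2 := by nlinarith
  have hy : 0 < l2 ^ 2 - l3 ^ 2 := by nlinarith
  have hz : 0 < l3 ^ 2 - l4 ^ 2 := by nlinarith
  have hxy : 0 < l1 ^ 2 - l3 ^ 2 := by linarith
  have hyz : 0 < l2 ^ 2 - l4 ^ 2 := by linarith
  obtain ⟨hf, ht⟩ := quadratic_beyond_larger_root hN hy (by positivity) hα hr1 hr2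
    ((lt_div_iff₀ (by positivity)).2 hlo)
  obtain ⟨s, k, m, e0, e3, p1, p2, q1, q2⟩ := exists_lyapunov_coefficients h12 h23 h34 s12 s13
    s14 s23 s24 s34 hf ht
  have hF : fderiv ℝ (fun q => Hfun l1 l2 l3 l4 q
      + (2 * (l1 + l3) * (l1 + l4) * (l3 + l4) * k
        / (2 * (l1 + l3) * (l1 + l4) * (l3 + l4))) * Ifun l1 l2 l3 l4 q
      + m * C1fun q + (-(s * b / a)) * C2fun q)
      = fun q => coupledForm
        ![1 / (l2 + l3) + 2 * k * (l2 ^ 2 + l3 ^ 2) + m,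
          1 / (l1 + l3) + 2 * k * (l1 ^ 2 + l3 ^ 2) + m,
          1 / (l1 + l2) + 2 * k * (l1 ^ 2 + l2 ^ 2) + m,
          1 / (l1 + l4) + 2 * k * (l1 ^ 2 + l4 ^ 2) + m,
          1 / (l2 + l4) + 2 * k * (l2 ^ 2 + l4 ^ 2) + m,
          1 / (l3 + l4) + 2 * k * (l3 ^ 2 + l4 ^ 2) + m] (-(s * b / a)) q := by
    refine fderiv_of_eq_coupledForm _ _ fun q => ?_
    rw [mul_div_cancel_left₀ k (by positivity), coupledForm_apply]
    simp only [Hfun, Ifun, C1fun, C2fun, Matrix.cons_val]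
    ring
  have hn : (-(s * b / a)) ^ 2 = s ^ 2 * (b ^ 2 / a ^ 2) := by ring
  rw [← hn] at q1 q2
  refine ⟨2 * (l1 + l3) * (l1 + l4) * (l3 + l4) * k, m, -(s * b / a), ?_, ?_⟩
  · rw [hF]
    ext w
    simp only [coupledForm_apply, Matrix.cons_val, e0, e3, zero_apply]
    field_simp
    ring
  · intro v hv hC1 hC2
    rw [hF, ContinuousLinearMap.fderiv, coupledForm_apply]
    simp only [fderiv_C1fun, fderiv_C2fun, Matrix.cons_val] at hC1 hC2
    have hab : a ^ 2 - b ^ 2 ≠ 0 := (sub_pos.2 hhi).ne'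
    have hv0 : v 0 = 0 := by
      apply mul_left_cancel₀ hab
      linear_combination a * hC2 - b * hC1
    have hv3 : v 3 = 0 := by
      apply mul_left_cancel₀ hab
      linear_combination a * hC1 - b * hC2
    simp only [Matrix.cons_val, hv0, hv3]
    have n1 := binary_form_nonneg p1 q1 (v 1) (v 4)
    have n2 := binary_form_nonneg p2 q2 (v 2) (v 5)
    by_cases h14 : v 1 ≠ 0 ∨ v 4 ≠ 0
    · have := binary_form_pos p1 q1 h14
      linarith
    · push Not at h14
      have h25 : v 2 ≠ 0 ∨ v 5 ≠ 0 := by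
        by_contra! h
        refine hv (funext fun i => ?_)
        fin_cases i <;> simp [hv0, hv3, h14.1, h14.2, h.1, h.2]
      have := binary_form_pos p2 q2 h25
      linarith
end
end

section
/- The quantity E1 = (λ1² + λ2λ3)(λ4² + λ2λ3) − λ1λ4(λ2 + λ3)² is strictly positive; consequently T = (λ1+λ4)²·E1 > 0. Moreover, with E2 = −(λ2²+λ1λ4)(λ3²+λ1λ4) + λ2λ3(λ1+λ4)² and S = (λ2+λ3)²·E2, one has f̃(S/T) ≤ 0, with equality if and only if λ1λ4 = λ2λ3; consequently α1 ≤ S/T ≤ α2, where α1 < α2 are the two real roots of f̃. -/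
theorem mul_add_mul_sub_pos {a b c d : ℝ} (hab : b < a) (hbc : c < b) (hcd : d < c)
    (scd : 0 < c + d) :
    0 < (a ^ 2 + b * c) * (d ^ 2 + b * c) - a * d * (b + c) ^ 2 := by
  have hc : 0 < c := by linarith
  have hb : 0 < b := by linarith
  have ha : 0 < a := by linarith
  have hbc' : 0 < b * c := mul_pos hb hc
  have had : 0 < a - d := by linarith
  have hpos : 0 < b * c * (a - d) ^ 2 := by positivity
  have key : (a ^ 2 + b * c) * (d ^ 2 + b * c) - a * d * (b + c) ^ 2
      = b * c * (a - d) ^ 2 - (b ^ 2 - a * d) * (a * d - c ^ 2) := by ring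
  rw [key]
  have h1 : b ^ 2 - a * d < b * (a - d) := by
    nlinarith [mul_pos (sub_pos.2 hab) scd, mul_pos (sub_pos.2 hab) (by linarith : 0 < b + d)]
  have h2 : a * d - c ^ 2 < c * (a - d) := by
    nlinarith [mul_pos ha (sub_pos.2 hcd), mul_pos hc (sub_pos.2 hcd)]
  rcases le_or_gt (b ^ 2 - a * d) 0 with h | h
  · have : 0 ≤ a * d - c ^ 2 := by nlinarith
    nlinarith [mul_nonneg (neg_nonneg.2 h) this]
  rcases le_or_gt (a * d - c ^ 2) 0 with h' | h'
  · nlinarith [mul_nonneg h.le (neg_nonneg.2 h')]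
  · have := mul_lt_mul'' h1 h2 h.le h'.le
    linarith [show b * (a - d) * (c * (a - d)) = b * c * (a - d) ^ 2 by ring]

theorem mem_Icc_of_quadratic_nonpos {s t u x y z : ℝ} (hs : 0 < s) (hxy : x < y)
    (hx : s * x ^ 2 + t * x + u = 0) (hy : s * y ^ 2 + t * y + u = 0)
    (hz : s * z ^ 2 + t * z + u ≤ 0) : z ∈ Set.Icc x y := by
  have ht : t = -(s * (x + y)) :=
    mul_left_cancel₀ (sub_pos.2 hxy).ne' (by linear_combination hy - hx)
  have hfac : s * z ^ 2 + t * z + u = s * ((z - x) * (z - y)) := by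
    rw [ht] at hx ⊢
    linear_combination hx
  rw [hfac] at hz
  have h : (z - x) * (z - y) ≤ 0 := nonpos_of_mul_nonpos_right hz hs
  constructor <;> by_contra! hlt <;> nlinarith

/-- `E1 > 0`, hence `T > 0`; moreover `f̃(S/T) ≤ 0` with equality iff
`λ1λ4 = λ2λ3`, and consequently `α1 ≤ S/T ≤ α2`. -/
theorem ST_between_roots
    (l1 l2 l3 l4 : ℝ) (h12 : l2 < l1) (h23 : l3 < l2) (h34 : l4 < l3)
    (s12 : 0 < l1 + l2) (s13 : 0 < l1 + l3) (s14 : 0 < l1 + l4)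
    (s23 : 0 < l2 + l3) (s24 : 0 < l2 + l4) (s34 : 0 < l3 + l4)
    (St Tt Ut : ℝ)
    (hSt : St = (l1^2 - l4^2)^2)
    (hTt : Tt = -(2 * ((l1^2 - l2^2) * (l3^2 - l4^2) + (l1^2 - l3^2) * (l2^2 - l4^2))))
    (hUt : Ut = (l2^2 - l3^2)^2)
    (α1 α2 : ℝ) (hα : α1 < α2)
    (hr1 : St * α1 ^ 2 + Tt * α1 + Ut = 0)
    (hr2 : St * α2 ^ 2 + Tt * α2 + Ut = 0)
    (E1 E2 S T : ℝ)
    (hE1 : E1 = (l1^2 + l2*l3) * (l4^2 + l2*l3) - l1*l4 * (l2 + l3)^2)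
    (hE2 : E2 = -((l2^2 + l1*l4) * (l3^2 + l1*l4)) + l2*l3 * (l1 + l4)^2)
    (hS : S = (l2 + l3)^2 * E2) (hT : T = (l1 + l4)^2 * E1) :
    0 < E1 ∧ 0 < T ∧
    St * (S / T) ^ 2 + Tt * (S / T) + Ut ≤ 0 ∧
    (St * (S / T) ^ 2 + Tt * (S / T) + Ut = 0 ↔ l1 * l4 = l2 * l3) ∧
    α1 ≤ S / T ∧ S / T ≤ α2 := by
  have hE1pos : 0 < E1 := hE1 ▸ mul_add_mul_sub_pos h12 h23 h34 s34
  have hTpos : 0 < T := hT ▸ mul_pos (pow_pos s14 2) hE1pos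
  have sq_sub_pos : ∀ {x y : ℝ}, y < x → 0 < x + y → 0 < x ^ 2 - y ^ 2 := fun {x y} h h' => by
    rw [sq_sub_sq]
    exact mul_pos h' (sub_pos.2 h)
  have hStpos : 0 < St := hSt ▸ pow_pos (sq_sub_pos (by linarith) s14) 2
  obtain ⟨K, hK, hval⟩ : ∃ K, 0 < K ∧
      St * (S / T) ^ 2 + Tt * (S / T) + Ut = -(K * (l1 * l4 - l2 * l3) ^ 2) := by
    refine ⟨4 * ((l1 + l4) ^ 2 * (l2 + l3) ^ 2 *
      ((l1 ^ 2 - l2 ^ 2) * (l1 ^ 2 - l3 ^ 2) * (l2 ^ 2 - l4 ^ 2) * (l3 ^ 2 - l4 ^ 2))) / T ^ 2,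
      ?_, ?_⟩
    · have := sq_sub_pos h12 s12
      have := sq_sub_pos (h23.trans h12) s13
      have := sq_sub_pos (h34.trans h23) s24
      have := sq_sub_pos h34 s34
      positivity
    · have hnum : St * S ^ 2 + Tt * S * T + Ut * T ^ 2 =
          -(4 * ((l1 + l4) ^ 2 * (l2 + l3) ^ 2 *
            ((l1 ^ 2 - l2 ^ 2) * (l1 ^ 2 - l3 ^ 2) * (l2 ^ 2 - l4 ^ 2) * (l3 ^ 2 - l4 ^ 2))) *
            (l1 * l4 - l2 * l3) ^ 2) := by
        rw [hS, hT, hSt, hTt, hUt, hE1, hE2]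
        ring
      have hT0 := hTpos.ne'
      rw [div_mul_eq_mul_div, ← neg_div, ← hnum]
      field_simp
  have hle : St * (S / T) ^ 2 + Tt * (S / T) + Ut ≤ 0 := by
    rw [hval, neg_nonpos]
    positivity
  refine ⟨hE1pos, hTpos, hle, ?_, mem_Icc_of_quadratic_nonpos hStpos hα hr1 hr2 hle⟩
  rw [hval, neg_eq_zero, mul_eq_zero, or_iff_right hK.ne', sq_eq_zero_iff, sub_eq_zero]
end
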